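/- arXiv:1604.03347 — 3 statements merged into one kernel-verified Lean document; each statement's English description precedes it below -/
import Mathlib

section
/- For every prime p, the number of medial quasigroups of order p^2 that admit an affine form over the elementary abelian group Z_p × Z_p, counted up to isomorphism, is exactly p^4 - p^2 - p - 1. -/
/-- A binary operation is a quasigroup operation if all left and right
translations are bijective. -/
def IsQuasigroup {Q : Type*} (op : Q → Q → Q) : Prop :=
  (∀ a : Q, Function.Bijective fun x => op a x) ∧
  (∀ a : Q, Function.Bijective fun x => op x a)

/-- The medial law. -/
def IsMedial {Q : Type*} (op : Q → Q → Q) : Prop :=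
  ∀ x y u v : Q, op (op x y) (op u v) = op (op x u) (op y v)

/-- A quasigroup `(Q, op)` admits an affine form over an abelian group `G` if,
after identifying `Q` with `G` via a bijection, the operation is
`x * y = φ(x) + ψ(y) + c` for automorphisms `φ, ψ` of `G` and `c ∈ G`. -/
def AdmitsAffineForm {Q : Type*} (op : Q → Q → Q) (G : Type*) [AddCommGroup G] : Prop :=
  ∃ (e : Q ≃ G) (φ ψ : G ≃+ G) (c : G),
    ∀ x y : Q, e (op x y) = φ (e x) + ψ (e y) + c

/-- Isomorphism of binary structures (quasigroups). -/
def QuasigroupIso {Q₁ Q₂ : Type*} (op₁ : Q₁ → Q₁ → Q₁) (op₂ : Q₂ → Q₂ → Q₂) : Prop :=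
  ∃ f : Q₁ ≃ Q₂, ∀ x y : Q₁, f (op₁ x y) = op₂ (f x) (f y)

/-- `mqG G` : the number of medial quasigroups admitting an affine form over the
abelian group `G`, up to isomorphism. -/
noncomputable def mqG (G : Type*) [AddCommGroup G] : ℕ :=
  Nat.card (Quot fun
    (op₁ op₂ : {op : G → G → G // IsQuasigroup op ∧ IsMedial op ∧ AdmitsAffineForm op G}) =>
    QuasigroupIso op₁.1 op₂.1)

/-- `mqN n` : the number of medial quasigroups of order `n`, up to isomorphism. -/
noncomputable def mqN (n : ℕ) : ℕ :=
  Nat.card (Quot fun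
    (op₁ op₂ : {op : Fin n → Fin n → Fin n // IsQuasigroup op ∧ IsMedial op}) =>
    QuasigroupIso op₁.1 op₂.1)


theorem qiso_symm {Q₁ Q₂ : Type*} {o₁ : Q₁ → Q₁ → Q₁} {o₂ : Q₂ → Q₂ → Q₂}
    (h : QuasigroupIso o₁ o₂) : QuasigroupIso o₂ o₁ := by
  obtain ⟨f, hf⟩ := h
  refine ⟨f.symm, fun x y => ?_⟩
  apply f.injective
  rw [hf]; simp

theorem qiso_trans {Q₁ Q₂ Q₃ : Type*} {o₁ : Q₁ → Q₁ → Q₁} {o₂ : Q₂ → Q₂ → Q₂}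
    {o₃ : Q₃ → Q₃ → Q₃}
    (h : QuasigroupIso o₁ o₂) (h' : QuasigroupIso o₂ o₃) : QuasigroupIso o₁ o₃ := by
  obtain ⟨f, hf⟩ := h
  obtain ⟨g, hg⟩ := h'
  exact ⟨f.trans g, fun x y => by simp [hf, hg]⟩

theorem qiso_refl {Q₁ : Type*} (o₁ : Q₁ → Q₁ → Q₁) : QuasigroupIso o₁ o₁ :=
  ⟨Equiv.refl _, fun x y => by simp⟩

/-- isomorphisms of affine operations are affine -/
theorem qiso_affine {G : Type*} [AddCommGroup G] (φ ψ φ' ψ' : G ≃+ G) (c c' : G)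
    (h : QuasigroupIso (fun x y => φ x + ψ y + c) (fun x y => φ' x + ψ' y + c')) :
    ∃ (α : G ≃+ G) (u : G), (∀ x, α (φ x) = φ' (α x)) ∧ (∀ x, α (ψ x) = ψ' (α x)) ∧
      c' = α c + (u - φ' u - ψ' u) := by
  obtain ⟨f, hf⟩ := h
  have h1 : ∀ x, f (φ x + c) = φ' (f x) + ψ' (f 0) + c' := fun x => by
    have := hf x 0; simpa using this
  have h2 : ∀ y, f (ψ y + c) = φ' (f 0) + ψ' (f y) + c' := fun x => by
    have := hf 0 x; simpa using this
  have h3 : f c = φ' (f 0) + ψ' (f 0) + c' := by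
    have := hf 0 0; simpa using this
  have hadd : ∀ u v, f (u + v + c) - f c = (f (u + c) - f c) + (f (v + c) - f c) := by
    intro u v
    have e0 := hf (φ.symm u) (ψ.symm v)
    have e1 := h1 (φ.symm u)
    have e2 := h2 (ψ.symm v)
    simp only [AddEquiv.apply_symm_apply] at e0 e1 e2
    rw [e0, e1, e2, h3]; abel
  let α : G ≃+ G :=
    { toEquiv := ((Equiv.addRight c).trans f).trans (Equiv.subRight (f c))
      map_add' := fun u v => by simpa using hadd u v }
  have hα : ∀ z, α z = f (z + c) - f c := fun z => rfl
  have hz : ∀ z, f z - f 0 = α z := by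
    intro z
    have e1 : α (z - c) = f z - f c := by rw [hα]; simp
    have e2 : α (0 - c) = f 0 - f c := by rw [hα]; simp
    have : α z = α (z - c) - α (0 - c) := by rw [← map_sub]; simp
    rw [this, e1, e2]; abel
  refine ⟨α, f 0, fun x => ?_, fun x => ?_, ?_⟩
  · rw [hα, h1, h3, ← hz, map_sub]; abel
  · rw [hα, h2, h3, ← hz, map_sub]; abel
  · rw [← hz, h3]; abel

/-- affine maps give isomorphisms -/
theorem qiso_of_affine {G : Type*} [AddCommGroup G] (o o' : G → G → G) (φ ψ φ' ψ' : G → G)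
    (c c' : G) (ho : ∀ x y, o x y = φ x + ψ y + c) (ho' : ∀ x y, o' x y = φ' x + ψ' y + c')
    (α : G ≃+ G) (u : G)
    (hφ' : ∀ x y, φ' (x + y) = φ' x + φ' y)
    (hψ' : ∀ x y, ψ' (x + y) = ψ' x + ψ' y)
    (h1 : ∀ x, α (φ x) = φ' (α x)) (h2 : ∀ x, α (ψ x) = ψ' (α x))
    (h3 : c' + φ' u + ψ' u = α c + u) : QuasigroupIso o o' := by
  refine ⟨α.toEquiv.trans (Equiv.addRight u), fun x y => ?_⟩
  simp only [Equiv.trans_apply, Equiv.coe_addRight, AddEquiv.toEquiv_eq_coe,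
    EquivLike.coe_coe, ho, ho', map_add, h1, h2, hφ', hψ']
  rw [add_assoc _ (α c), ← h3]; abel

/-- norm form -/
def nrm {F : Type*} [Field F] (t d : F) (a : F × F) : F := a.1 ^ 2 + a.1 * a.2 * t + a.2 ^ 2 * d

/-- multiplication of `F[X]/(X^2 - tX + d)` in coordinates -/
def kmul {F : Type*} [Field F] (t d : F) (a x : F × F) : F × F :=
  (a.1 * x.1 - d * a.2 * x.2, a.1 * x.2 + a.2 * x.1 + t * a.2 * x.2)

section
variable {F : Type*} [Field F]

theorem kmul_comm (t d : F) (a b : F × F) : kmul t d a b = kmul t d b a := by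
  ext <;> simp only [kmul] <;> ring

theorem kmul_assoc (t d : F) (a b c : F × F) :
    kmul t d (kmul t d a b) c = kmul t d a (kmul t d b c) := by
  ext <;> simp only [kmul] <;> ring

theorem kmul_add (t d : F) (a x y : F × F) :
    kmul t d a (x + y) = kmul t d a x + kmul t d a y := by
  ext <;> simp only [kmul, Prod.fst_add, Prod.snd_add] <;> ring

theorem nrm_kmul (t d : F) (a b : F × F) : nrm t d (kmul t d a b) = nrm t d a * nrm t d b := by
  simp only [kmul, nrm]; ring

/-- inverse -/
def kinv (t d : F) (a : F × F) : F × F := ((a.1 + t * a.2) / nrm t d a, - a.2 / nrm t d a)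

theorem kmul_kinv (t d : F) (a : F × F) (h : nrm t d a ≠ 0) : kmul t d a (kinv t d a) = (1, 0) := by
  ext <;> simp only [kmul, kinv] <;> field_simp <;> simp only [nrm] <;> ring

theorem kmul_one (t d : F) (a : F × F) : kmul t d a (1, 0) = a := by
  ext <;> simp [kmul]

theorem one_kmul (t d : F) (a : F × F) : kmul t d (1, 0) a = a := by
  ext <;> simp [kmul]

/-- multiplication by a unit -/
def kequiv (t d : F) (a : F × F) (h : nrm t d a ≠ 0) : F × F ≃+ F × F where
  toFun := kmul t d a
  invFun := kmul t d (kinv t d a)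
  left_inv x := by rw [← kmul_assoc, kmul_comm t d (kinv t d a), kmul_kinv t d a h, one_kmul]
  right_inv x := by rw [← kmul_assoc, kmul_kinv t d a h, one_kmul]
  map_add' := kmul_add t d a

theorem kequiv_apply (t d : F) (a x : F × F) (h : nrm t d a ≠ 0) :
    kequiv t d a h x = kmul t d a x := rfl

theorem nrm_ne_zero_of_inj (t d : F) (a : F × F) (h : ∀ x, kmul t d a x = 0 → x = 0) :
    nrm t d a ≠ 0 := by
  intro h0
  have h1 := h (a.1 + t * a.2, - a.2) (by
    simp only [nrm] at h0
    ext <;> simp only [kmul, Prod.fst_zero, Prod.snd_zero]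
    · linear_combination h0
    · ring)
  have e2 : a.2 = 0 := by simpa using congrArg Prod.snd h1
  have e1 : a.1 = 0 := by simpa [e2] using congrArg Prod.fst h1
  have := h (1, 0) (by ext <;> simp [kmul, e1, e2])
  simp at this

/-- representative operation -/
def aop (t d : F) (a b c : F × F) : F × F → F × F → F × F :=
  fun x y => kmul t d a x + kmul t d b y + c

theorem aop_good (t d : F) (a b c : F × F) (ha : nrm t d a ≠ 0) (hb : nrm t d b ≠ 0) :
    IsQuasigroup (aop t d a b c) ∧ IsMedial (aop t d a b c) ∧
      AdmitsAffineForm (aop t d a b c) (F × F) := by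
  refine ⟨⟨fun z => ?_, fun z => ?_⟩, ?_, ?_⟩
  · have := (((kequiv t d b hb).toEquiv.trans (Equiv.addLeft (kmul t d a z))).trans
      (Equiv.addRight c)).bijective
    exact this
  · have := (((kequiv t d a ha).toEquiv.trans (Equiv.addRight (kmul t d b z))).trans
      (Equiv.addRight c)).bijective
    exact this
  · intro x y u v
    simp only [aop, kmul_add, ← kmul_assoc, kmul_comm t d b a]
    abel
  · exact ⟨Equiv.refl _, kequiv t d a ha, kequiv t d b hb, c, fun x y => rfl⟩

/-- the canonical constants -/
def cvec : Option (Option F) → F × F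
  | none => 0
  | some none => (1, 0)
  | some (some l) => (-l, 1)

/-- allowed labels for `m = 1 - a - b` -/
def okc (t d : F) (m : F × F) : Option (Option F) → Prop
  | none => True
  | some none => nrm t d m = 0
  | some (some l) => m = 0 ∧ l ^ 2 - t * l + d = 0

theorem exists_label (t d : F) (m c : F × F) :
    ∃ (l : Option (Option F)) (g u : F × F), okc t d m l ∧ nrm t d g ≠ 0 ∧
      c = kmul t d g (cvec l) + kmul t d m u := by
  have n1 : nrm t d ((1, 0) : F × F) ≠ 0 := by simp [nrm]
  by_cases hm : nrm t d m = 0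
  swap
  · refine ⟨none, (1, 0), kmul t d (kinv t d m) c, trivial, n1, ?_⟩
    rw [← kmul_assoc, kmul_kinv t d m hm, one_kmul, one_kmul]; simp [cvec]
  by_cases hs : m.2 = 0
  · have hr : m.1 = 0 := by simpa [nrm, hs] using hm
    have hm0 : m = 0 := Prod.ext hr hs
    have z : ∀ u, kmul t d m u = 0 := fun u => by rw [hm0]; ext <;> simp [kmul]
    by_cases hc : nrm t d c = 0
    swap
    · exact ⟨some none, c, 0, hm, hc, by rw [z]; simp [cvec, kmul_one]⟩
    by_cases hc2 : c.2 = 0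
    · have hc1 : c.1 = 0 := by simpa [nrm, hc2] using hc
      refine ⟨none, (1, 0), 0, trivial, n1, ?_⟩
      rw [z]; ext <;> simp [cvec, kmul, hc1, hc2]
    · refine ⟨some (some (- c.1 / c.2)), (c.2, 0), 0, ⟨hm0, ?_⟩, by simp [nrm, hc2], ?_⟩
      · simp only [nrm] at hc
        field_simp
        linear_combination hc
      · rw [z]; ext <;> simp [cvec, kmul]; field_simp
  · -- c = k + m u
    have key : ∃ (k : F) (u : F × F), c = (k, 0) + kmul t d m u := by
      refine ⟨c.1 - c.2 * m.1 / m.2, (c.2 / m.2, 0), ?_⟩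
      ext <;> simp [kmul] <;> field_simp
      ring
    obtain ⟨k, u, hk⟩ := key
    by_cases hk0 : k = 0
    · refine ⟨none, (1, 0), u, trivial, n1, ?_⟩
      rw [hk, one_kmul]; simp [cvec, hk0]
    · refine ⟨some none, (k, 0), u, hm, by simp [nrm, hk0], ?_⟩
      rw [hk]; simp [cvec, kmul_one]

/-- every `aop` is isomorphic to one with canonical constant -/
theorem aop_normalize (t d : F) (a b c : F × F) :
    ∃ l, okc t d ((1, 0) - a - b) l ∧ QuasigroupIso (aop t d a b c) (aop t d a b (cvec l)) := by
  obtain ⟨l, g, u, hl, hg, hc⟩ := exists_label t d ((1, 0) - a - b) c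
  refine ⟨l, hl, qiso_symm ?_⟩
  refine qiso_of_affine _ _ (kmul t d a) (kmul t d b) (kmul t d a) (kmul t d b) (cvec l) c
    (fun _ _ => rfl) (fun _ _ => rfl) (kequiv t d g hg) u (kmul_add t d a) (kmul_add t d b) ?_ ?_ ?_
  · intro x; simp only [kequiv_apply, ← kmul_assoc, kmul_comm t d g a]
  · intro x; simp only [kequiv_apply, ← kmul_assoc, kmul_comm t d g b]
  · rw [hc, kequiv_apply]
    ext <;> simp [kmul] <;> ring

end

section
variable {F : Type*} [Field F]

theorem label_unique (t d : F) (m g u : F × F) (hg : nrm t d g ≠ 0) (l l' : Option (Option F))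
    (h : okc t d m l) (h' : okc t d m l')
    (he : cvec l' = kmul t d g (cvec l) + kmul t d m u) : l = l' := by
  have z0 : ∀ x : F × F, kmul t d x 0 = 0 := fun x => by ext <;> simp [kmul]
  have z1 : ∀ x : F × F, kmul t d 0 x = 0 := fun x => by ext <;> simp [kmul]
  have n1 : nrm t d ((1, 0) : F × F) = 1 := by simp [nrm]
  have nl : ∀ k : F, k ^ 2 - t * k + d = 0 → nrm t d ((-k, 1) : F × F) = 0 := fun k hk => by
    simp only [nrm]; linear_combination hk
  rcases l with _ | _ | l <;> rcases l' with _ | _ | l' <;> simp only [cvec, okc] at h h' he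
  · rfl
  · exfalso
    have := congrArg (nrm t d) he
    rw [z0, zero_add, nrm_kmul, h', n1] at this
    simp at this
  · exfalso
    rw [h'.1, z0, z1] at he
    simpa using congrArg Prod.snd he
  · exfalso
    rw [kmul_one] at he
    have e : g = kmul t d m (-u) := by
      have e1 : kmul t d m (-u) = - kmul t d m u := by ext <;> simp [kmul] <;> ring
      rw [e1]; exact eq_neg_of_add_eq_zero_left he.symm
    apply hg; rw [e, nrm_kmul, h, zero_mul]
  · rfl
  · exfalso
    rw [h'.1, z1, kmul_one, add_zero] at he
    exact hg (by rw [← he]; exact nl _ h'.2)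
  · exfalso
    rw [h.1, z1, add_zero] at he
    have := congrArg (kmul t d (kinv t d g)) he
    rw [← kmul_assoc, kmul_comm t d _ g, kmul_kinv t d g hg, one_kmul, z0] at this
    simpa using congrArg Prod.snd this
  · exfalso
    rw [h.1, z1, add_zero] at he
    have := congrArg (nrm t d) he
    rw [nrm_kmul, nl _ h.2, n1] at this
    simp at this
  · rw [h.1, z1, add_zero] at he
    have := congrArg (kmul t d (-(t - l), 1)) he
    rw [← kmul_assoc, kmul_comm t d _ g, kmul_assoc] at this
    have e0 : kmul t d (-(t - l), 1) (-l, 1) = 0 := by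
      ext <;> simp only [kmul, Prod.fst_zero, Prod.snd_zero]
      · linear_combination - h.2
      · ring
    rw [e0, z0] at this
    have := congrArg Prod.snd this
    simp only [kmul, Prod.snd_zero] at this
    congr 2
    linear_combination this

theorem scal_unique (t d t' d' k : F) (a' : F × F) (α : F × F ≃+ F × F)
    (hs : ∀ (c : F) x, α (c • x) = c • α x)
    (h : ∀ x, α (kmul t d (k, 0) x) = kmul t' d' a' (α x)) : a' = (k, 0) := by
  have e := h (α.symm (1, 0))
  have : kmul t d (k, 0) (α.symm (1, 0)) = k • (α.symm (1, 0)) := by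
    ext <;> simp [kmul]
  rw [this, hs, AddEquiv.apply_symm_apply, kmul_one] at e
  rw [← e]; ext <;> simp

theorem cyc_unique (t d t' d' : F) (α : F × F ≃+ F × F)
    (hs : ∀ (c : F) x, α (c • x) = c • α x)
    (h : ∀ x, α (kmul t d (0, 1) x) = kmul t' d' (0, 1) (α x)) : t = t' ∧ d = d' := by
  have key : ∀ y, kmul t' d' (0, 1) (kmul t' d' (0, 1) y) = t • kmul t' d' (0, 1) y - d • y := by
    intro y
    obtain ⟨x, rfl⟩ := α.surjective y
    rw [← h, ← h, ← hs, ← hs, ← map_sub]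
    congr 1
    ext <;> simp [kmul] <;> ring
  have e := key (1, 0)
  have e1 := congrArg Prod.fst e
  have e2 := congrArg Prod.snd e
  simp [kmul] at e1 e2
  exact ⟨e2.symm, e1.symm⟩

theorem cyc_commute (t d : F) (α : F × F ≃+ F × F)
    (hs : ∀ (c : F) x, α (c • x) = c • α x)
    (h : ∀ x, α (kmul t d (0, 1) x) = kmul t d (0, 1) (α x)) :
    nrm t d (α (1, 0)) ≠ 0 ∧ ∀ x, α x = kmul t d (α (1, 0)) x := by
  have key : ∀ x, α x = kmul t d (α (1, 0)) x := by
    intro x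
    have e0 : α (0, 1) = kmul t d (0, 1) (α (1, 0)) := by rw [← h, kmul_one]
    have e1 : x = x.1 • ((1, 0) : F × F) + x.2 • ((0, 1) : F × F) := by ext <;> simp
    conv_lhs => rw [e1, map_add, hs, hs, e0]
    ext <;> simp [kmul] <;> ring
  refine ⟨nrm_ne_zero_of_inj t d _ fun x hx => ?_, key⟩
  rw [← key] at hx
  simpa using hx

theorem kmul_cancel (t d : F) (g a b : F × F) (hg : nrm t d g ≠ 0)
    (h : kmul t d g a = kmul t d g b) : a = b := (kequiv t d g hg).injective h

/-- non-scalar maps are cyclic -/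
theorem exists_cyclic (χ : F × F ≃+ F × F) (hs : ∀ (c : F) x, χ (c • x) = c • χ x)
    (hn : ¬ ∃ k : F, ∀ x, χ x = k • x) :
    ∃ (t d : F) (L : F × F ≃+ F × F), (∀ (c : F) x, L (c • x) = c • L x) ∧
      (∀ x, L (kmul t d (0, 1) x) = χ (L x)) ∧
      ∀ φ : F × F ≃+ F × F, (∀ (c : F) x, φ (c • x) = c • φ x) → (∀ x, φ (χ x) = χ (φ x)) →
        ∃ a, ∀ x, L (kmul t d a x) = φ (L x) := by
  have hv : ∃ v, v.1 * (χ v).2 - v.2 * (χ v).1 ≠ 0 := by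
    by_contra hcon
    push Not at hcon
    have e1 := hcon (1, 0)
    have e2 := hcon (0, 1)
    have e3 := hcon (1, 1)
    have e4 : ((1, 1) : F × F) = (1, 0) + (0, 1) := by ext <;> simp
    rw [e4, map_add] at e3
    simp at e1 e2 e3
    apply hn
    refine ⟨(χ (1, 0)).1, fun x => ?_⟩
    have e5 : x = x.1 • ((1, 0) : F × F) + x.2 • ((0, 1) : F × F) := by ext <;> simp
    conv_lhs => rw [e5, map_add, hs, hs]
    ext
    · simp [e2, mul_comm]
    · simp [e1]
      rw [e1, e2] at e3
      linear_combination x.2 * e3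
  obtain ⟨v, hv⟩ := hv
  obtain ⟨w, hw⟩ : ∃ w, w = χ v := ⟨_, rfl⟩
  rw [← hw] at hv
  have hD := mul_inv_cancel₀ hv
  let L : F × F ≃+ F × F :=
    { toFun := fun x => x.1 • v + x.2 • w
      invFun := fun z => ((z.1 * w.2 - z.2 * w.1) / (v.1 * w.2 - v.2 * w.1),
        (v.1 * z.2 - v.2 * z.1) / (v.1 * w.2 - v.2 * w.1))
      left_inv := fun x => by
        ext <;> simp only [Prod.fst_add, Prod.snd_add, Prod.smul_fst, Prod.smul_snd, smul_eq_mul,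
          div_eq_mul_inv]
        · linear_combination x.1 * hD
        · linear_combination x.2 * hD
      right_inv := fun x => by
        ext <;> simp only [Prod.fst_add, Prod.snd_add, Prod.smul_fst, Prod.smul_snd, smul_eq_mul,
          div_eq_mul_inv]
        · linear_combination x.1 * hD
        · linear_combination x.2 * hD
      map_add' := fun x y => by
        ext <;> simp <;> ring }
  have hL : ∀ x, L x = x.1 • v + x.2 • w := fun x => rfl
  have hLs : ∀ (c : F) x, L (c • x) = c • L x := fun c x => by
    rw [hL, hL]; ext <;> simp <;> ring
  obtain ⟨s, hs'⟩ := L.surjective (χ w)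
  have hA : ∀ x, L (kmul s.2 (-s.1) (0, 1) x) = χ (L x) := by
    intro x
    rw [hL x, map_add, hs, hs, ← hs', ← hw, hL, hL]
    ext <;> simp [kmul] <;> ring
  refine ⟨s.2, -s.1, L, hLs, hA, fun φ hφ hc => ?_⟩
  obtain ⟨a, ha⟩ := L.surjective (φ v)
  refine ⟨a, fun x => ?_⟩
  rw [hL x, map_add, hφ, hφ, hw, hc, ← ha, ← hA, ← hLs, ← hLs, ← map_add]
  congr 1
  ext <;> simp [kmul] <;> ring

end

/-- boolean labels -/
def bvec {F : Type*} [Field F] : Bool → F × F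
  | false => 0
  | true => (1, 0)

/-- scalar family -/
abbrev IS (F : Type*) [Field F] := {q : Bool × F × F // q.2.1 ≠ 0 ∧ q.2.2 ≠ 0 ∧
  (q.1 = true → q.2.1 + q.2.2 = 1)}

/-- first map non-scalar: `(l, x, y, t, d)` -/
abbrev IN (F : Type*) [Field F] := {q : Option (Option F) × F × F × F × F //
  q.2.2.2.2 ≠ 0 ∧ nrm q.2.2.2.1 q.2.2.2.2 (q.2.1, q.2.2.1) ≠ 0 ∧
    okc q.2.2.2.1 q.2.2.2.2 (1 - q.2.1, -1 - q.2.2.1) q.1}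

/-- first map scalar, second not: `(l, a, t, d)` -/
abbrev IM (F : Type*) [Field F] := {q : Bool × F × F × F // q.2.1 ≠ 0 ∧ q.2.2.2 ≠ 0 ∧
  (q.1 = true → nrm q.2.2.1 q.2.2.2 (1 - q.2.1, -1) = 0)}

section
variable {F : Type*} [Field F]

/-- goodness of an operation -/
abbrev Good (F : Type*) [Field F] :=
  {op : F × F → F × F → F × F // IsQuasigroup op ∧ IsMedial op ∧ AdmitsAffineForm op (F × F)}

/-- the representatives -/
def rep : IS F ⊕ (IN F ⊕ IM F) → Good F
  | .inl ⟨(l, a, b), h⟩ => ⟨aop 0 0 (a, 0) (b, 0) (bvec l), aop_good _ _ _ _ _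
      (by simpa [nrm] using h.1) (by simpa [nrm] using h.2.1)⟩
  | .inr (.inl ⟨(l, x, y, t, d), h⟩) => ⟨aop t d (0, 1) (x, y) (cvec l), aop_good _ _ _ _ _
      (by simpa [nrm] using h.1) h.2.1⟩
  | .inr (.inr ⟨(l, a, t, d), h⟩) => ⟨aop t d (a, 0) (0, 1) (bvec l), aop_good _ _ _ _ _
      (by simpa [nrm] using h.1) (by simpa [nrm] using h.2.1)⟩

theorem aop_iso (hF : ∀ (α : F × F ≃+ F × F) (c : F) x, α (c • x) = c • α x)
    {t d t' d' : F} {a b c a' b' c' : F × F} (ha : nrm t d a ≠ 0)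
    (hb : nrm t d b ≠ 0) (ha' : nrm t' d' a' ≠ 0) (hb' : nrm t' d' b' ≠ 0)
    (h : QuasigroupIso (aop t d a b c) (aop t' d' a' b' c')) :
    ∃ (α : F × F ≃+ F × F) (u : F × F), (∀ (c : F) x, α (c • x) = c • α x) ∧
      (∀ x, α (kmul t d a x) = kmul t' d' a' (α x)) ∧
      (∀ x, α (kmul t d b x) = kmul t' d' b' (α x)) ∧
      c' = α c + kmul t' d' ((1, 0) - a' - b') u := by
  obtain ⟨α, u, h1, h2, h3⟩ := qiso_affine (kequiv t d a ha) (kequiv t d b hb)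
    (kequiv t' d' a' ha') (kequiv t' d' b' hb') c c' h
  refine ⟨α, u, hF α, h1, h2, ?_⟩
  rw [h3, kequiv_apply, kequiv_apply]
  congr 1
  ext <;> simp [kmul] <;> ring

theorem bvec_eq (l : Bool) : (bvec l : F × F) = cvec (if l then some none else none) := by
  cases l <;> simp [bvec, cvec]

theorem rep_inj (hF : ∀ (α : F × F ≃+ F × F) (c : F) x, α (c • x) = c • α x)
    (i j : IS F ⊕ (IN F ⊕ IM F)) (h : QuasigroupIso (rep i).1 (rep j).1) : i = j := by
  rcases i with ⟨⟨l, a, b⟩, hi⟩ | ⟨⟨l, x, y, t, d⟩, hi⟩ | ⟨⟨l, a, t, d⟩, hi⟩ <;>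
  rcases j with ⟨⟨l', a', b'⟩, hj⟩ | ⟨⟨l', x', y', t', d'⟩, hj⟩ | ⟨⟨l', a', t', d'⟩, hj⟩ <;>
  simp only [rep] at h
  · obtain ⟨α, u, hs, h1, h2, h3⟩ := aop_iso hF (by simpa [nrm] using hi.1)
      (by simpa [nrm] using hi.2.1) (by simpa [nrm] using hj.1) (by simpa [nrm] using hj.2.1) h
    have e1 := scal_unique _ _ _ _ _ _ α hs h1
    have e2 := scal_unique _ _ _ _ _ _ α hs h2
    simp only [Prod.mk.injEq, and_true] at e1 e2
    subst e1 e2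
    have : l = l' := by
      have hi3 := hi.2.2
      have hj3 := hj.2.2
      simp only at hi3 hj3
      have key : a' + b' = 1 → kmul 0 0 ((1, 0) - (a', 0) - (b', 0)) u = 0 := fun h => by
        have : (1 : F) - a' - b' = 0 := by linear_combination -h
        ext <;> simp [kmul, this]
      cases l <;> cases l'
      · rfl
      · rw [key (hj3 rfl)] at h3; simp [bvec] at h3
      · rw [key (hi3 rfl)] at h3
        simp only [bvec, add_zero] at h3
        have := α.map_eq_zero_iff.1 h3.symm
        simp at this
      · rfl
    subst this; rfl
  · obtain ⟨α, u, hs, h1, h2, h3⟩ := aop_iso hF (by simpa [nrm] using hi.1)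
      (by simpa [nrm] using hi.2.1) (by simpa [nrm] using hj.1) hj.2.1 h
    have e1 := scal_unique _ _ _ _ _ _ α hs h1
    simp at e1
  · obtain ⟨α, u, hs, h1, h2, h3⟩ := aop_iso hF (by simpa [nrm] using hi.1)
      (by simpa [nrm] using hi.2.1) (by simpa [nrm] using hj.1) (by simpa [nrm] using hj.2.1) h
    have e1 := scal_unique _ _ _ _ _ _ α hs h2
    simp at e1
  · obtain ⟨α, u, hs, h1, h2, h3⟩ := aop_iso hF (by simpa [nrm] using hj.1)
      (by simpa [nrm] using hj.2.1) (by simpa [nrm] using hi.1) hi.2.1 (qiso_symm h)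
    have e1 := scal_unique _ _ _ _ _ _ α hs h1
    simp at e1
  · obtain ⟨α, u, hs, h1, h2, h3⟩ := aop_iso hF (by simpa [nrm] using hi.1) hi.2.1
      (by simpa [nrm] using hj.1) hj.2.1 h
    obtain ⟨rfl, rfl⟩ := cyc_unique _ _ _ _ α hs h1
    obtain ⟨hg, hα⟩ := cyc_commute _ _ α hs h1
    have e := h2 (1, 0)
    rw [kmul_one, hα, kmul_comm t d (x', y')] at e
    have e' := kmul_cancel _ _ _ _ _ hg e
    simp only [Prod.mk.injEq] at e'
    obtain ⟨rfl, rfl⟩ := e'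
    rw [hα] at h3
    have em : ((1, 0) : F × F) - (0, 1) - (x, y) = (1 - x, -1 - y) := by ext <;> simp
    rw [em] at h3
    have := label_unique _ _ _ _ _ hg _ _ hi.2.2 hj.2.2 h3
    simp only at this
    subst this; rfl
  · obtain ⟨α, u, hs, h1, h2, h3⟩ := aop_iso hF (by simpa [nrm] using hj.1)
      (by simpa [nrm] using hj.2.1) (by simpa [nrm] using hi.1) hi.2.1 (qiso_symm h)
    have e1 := scal_unique _ _ _ _ _ _ α hs h1
    simp at e1
  · obtain ⟨α, u, hs, h1, h2, h3⟩ := aop_iso hF (by simpa [nrm] using hj.1)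
      (by simpa [nrm] using hj.2.1) (by simpa [nrm] using hi.1) (by simpa [nrm] using hi.2.1)
      (qiso_symm h)
    have e1 := scal_unique _ _ _ _ _ _ α hs h2
    simp at e1
  · obtain ⟨α, u, hs, h1, h2, h3⟩ := aop_iso hF (by simpa [nrm] using hi.1)
      (by simpa [nrm] using hi.2.1) (by simpa [nrm] using hj.1) hj.2.1 h
    have e1 := scal_unique _ _ _ _ _ _ α hs h1
    simp at e1
  · obtain ⟨α, u, hs, h1, h2, h3⟩ := aop_iso hF (by simpa [nrm] using hi.1)
      (by simpa [nrm] using hi.2.1) (by simpa [nrm] using hj.1) (by simpa [nrm] using hj.2.1) h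
    obtain ⟨rfl, rfl⟩ := cyc_unique _ _ _ _ α hs h2
    obtain ⟨hg, hα⟩ := cyc_commute _ _ α hs h2
    have e1 := scal_unique _ _ _ _ _ _ α hs h1
    simp only [Prod.mk.injEq, and_true] at e1
    subst e1
    rw [hα, bvec_eq, bvec_eq] at h3
    have em : ((1, 0) : F × F) - (a', 0) - (0, 1) = (1 - a', -1) := by ext <;> simp
    rw [em] at h3
    have hi3 := hi.2.2
    have hj3 := hj.2.2
    simp only at hi3 hj3
    have := label_unique _ _ _ _ _ hg _ _ (by cases l <;> simp [okc]; exact hi3 rfl)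
      (by cases l' <;> simp [okc]; exact hj3 rfl) h3
    have hl : l = l' := by cases l <;> cases l' <;> simp at this ⊢
    subst hl; rfl

theorem rep_surj (hF : ∀ (α : F × F ≃+ F × F) (c : F) x, α (c • x) = c • α x)
    (o : Good F) : ∃ i, QuasigroupIso o.1 (rep i : Good F).1 := by
  obtain ⟨op, hq, hm, e, φ, ψ, c, he⟩ := o
  simp only
  have h0 : QuasigroupIso op (fun x y => φ x + ψ y + c) := ⟨e, fun x y => he x y⟩
  have hm' : IsMedial (fun x y => φ x + ψ y + c) := by
    intro x y u v
    have := congrArg e (hm (e.symm x) (e.symm y) (e.symm u) (e.symm v))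
    simpa [he] using this
  have hc : ∀ x, φ (ψ x) = ψ (φ x) := by
    intro x
    have := hm' 0 x 0 0
    simp only [map_add, map_zero, zero_add, add_zero] at this
    have h2 : φ (ψ x) + (φ c + (ψ c + c)) = ψ (φ x) + (φ c + (ψ c + c)) := by
      rw [← sub_eq_zero] at this ⊢
      rw [← this]; abel
    exact add_right_cancel h2
  -- transfer along L
  have tr : ∀ (t d : F) (a b : F × F) (L : F × F ≃+ F × F),
      (∀ x, L (kmul t d a x) = φ (L x)) → (∀ x, L (kmul t d b x) = ψ (L x)) →
      nrm t d a ≠ 0 ∧ nrm t d b ≠ 0 ∧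
      ∃ l, okc t d ((1, 0) - a - b) l ∧ QuasigroupIso op (aop t d a b (cvec l)) := by
    intro t d a b L h1 h2
    refine ⟨nrm_ne_zero_of_inj t d _ fun x hx => ?_, nrm_ne_zero_of_inj t d _ fun x hx => ?_, ?_⟩
    · have := h1 x; rw [hx, map_zero] at this; simpa using this.symm
    · have := h2 x; rw [hx, map_zero] at this; simpa using this.symm
    obtain ⟨l, hl, hi⟩ := aop_normalize t d a b (L.symm c)
    refine ⟨l, hl, qiso_trans h0 (qiso_trans (qiso_symm ?_) hi)⟩
    exact qiso_of_affine _ _ (kmul t d a) (kmul t d b) φ ψ (L.symm c) c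
      (fun _ _ => rfl) (fun _ _ => rfl) L 0 (map_add φ) (map_add ψ) h1 h2 (by simp)
  by_cases hφ : ∃ k : F, ∀ x, φ x = k • x
  swap
  · obtain ⟨t, d, L, hLs, hA, hcom⟩ := exists_cyclic φ (hF φ) hφ
    obtain ⟨b, hb⟩ := hcom ψ (hF ψ) (fun x => (hc x).symm)
    obtain ⟨n1, n2, l, hl, hi⟩ := tr t d (0, 1) b L hA hb
    refine ⟨.inr (.inl ⟨(l, b.1, b.2, t, d), by simpa [nrm] using n1, n2, ?_⟩), hi⟩
    have em : ((1, 0) : F × F) - (0, 1) - b = (1 - b.1, -1 - b.2) := by ext <;> simp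
    rwa [em] at hl
  obtain ⟨k, hk⟩ := hφ
  by_cases hψ : ∃ k : F, ∀ x, ψ x = k • x
  swap
  · obtain ⟨t, d, L, hLs, hA, -⟩ := exists_cyclic ψ (hF ψ) hψ
    obtain ⟨n1, n2, l, hl, hi⟩ := tr t d (k, 0) (0, 1) L (fun x => by
      rw [hk, ← hLs]; congr 1; ext <;> simp [kmul]) hA
    have em : ((1, 0) : F × F) - (k, 0) - (0, 1) = (1 - k, -1) := by ext <;> simp
    rw [em] at hl
    rcases l with _ | _ | l
    · exact ⟨.inr (.inr ⟨(false, k, t, d), by simpa [nrm] using n1, by simpa [nrm] using n2,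
        by simp⟩), hi⟩
    · exact ⟨.inr (.inr ⟨(true, k, t, d), by simpa [nrm] using n1, by simpa [nrm] using n2,
        fun _ => hl⟩), hi⟩
    · exfalso
      simpa using congrArg Prod.snd hl.1
  · obtain ⟨k', hk'⟩ := hψ
    obtain ⟨n1, n2, l, hl, hi⟩ := tr 0 0 (k, 0) (k', 0) (AddEquiv.refl _) (fun x => by
      simp only [AddEquiv.refl_apply]; rw [hk]; ext <;> simp [kmul]) (fun x => by
      simp only [AddEquiv.refl_apply]; rw [hk']; ext <;> simp [kmul])
    have m1 : k ≠ 0 := by simpa [nrm] using n1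
    have m2 : k' ≠ 0 := by simpa [nrm] using n2
    rcases l with _ | _ | l
    · exact ⟨.inl ⟨(false, k, k'), m1, m2, by simp⟩, hi⟩
    · refine ⟨.inl ⟨(true, k, k'), m1, m2, fun _ => ?_⟩, hi⟩
      simp [okc, nrm] at hl
      linear_combination -hl
    · have hl1 := congrArg Prod.fst hl.1
      have hl2 := hl.2
      simp at hl1 hl2
      subst hl2
      refine ⟨.inl ⟨(true, k, k'), m1, m2, fun _ => ?_⟩, qiso_trans hi ?_⟩
      · simp only; linear_combination -hl1
      · refine qiso_of_affine _ _ (kmul 0 0 (k, 0)) (kmul 0 0 (k', 0)) (kmul 0 0 (k, 0))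
          (kmul 0 0 (k', 0)) _ _ (fun _ _ => rfl) (fun _ _ => rfl) AddEquiv.prodComm 0
          (kmul_add _ _ _) (kmul_add _ _ _) ?_ ?_ ?_
        · intro x; ext <;> simp [kmul]
        · intro x; ext <;> simp [kmul]
        · ext <;> simp [kmul, cvec, bvec]

theorem card_quot (hF : ∀ (α : F × F ≃+ F × F) (c : F) x, α (c • x) = c • α x) :
    mqG (F × F) = Nat.card (IS F ⊕ (IN F ⊕ IM F)) := by
  unfold mqG
  symm
  refine Nat.card_eq_of_bijective (fun i => Quot.mk _ (rep i)) ⟨fun i j h => ?_, fun q => ?_⟩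
  · apply rep_inj hF
    have hE : Equivalence (fun (o₁ o₂ : Good F) => QuasigroupIso o₁.1 o₂.1) :=
      ⟨fun o => qiso_refl _, qiso_symm, qiso_trans⟩
    exact hE.eqvGen_iff.1 (Quot.eqvGen_exact h)
  · induction q using Quot.ind with
    | _ o =>
      obtain ⟨i, hi⟩ := rep_surj hF o
      refine ⟨i, Eq.symm (Quot.sound ?_)⟩
      exact hi

end

section counting
open scoped Classical in
theorem card_sub_eq {α : Type*} [Fintype α] (P : α → Prop) :
    (Nat.card {x // P x} : ℤ) = ∑ x, if P x then 1 else 0 := by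
  rw [Nat.card_eq_fintype_card, Fintype.card_subtype, Finset.card_filter]
  push_cast; rfl

theorem sum_off1 {F : Type*} [Fintype F] (f : F → ℤ) (a : F) (k : ℤ)
    (h : ∀ x, x ≠ a → f x = k) : ∑ x, f x = Fintype.card F * k + (f a - k) := by
  classical
  have : ∀ x, f x = k + (if x = a then f a - k else 0) := fun x => by
    by_cases hx : x = a
    · subst hx; simp
    · simp [hx, h x hx]
  rw [Finset.sum_congr rfl fun x _ => this x, Finset.sum_add_distrib]
  simp

theorem sum_off2 {F : Type*} [Fintype F] (f : F → ℤ) (a b : F) (k : ℤ) (hab : a ≠ b)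
    (h : ∀ x, x ≠ a → x ≠ b → f x = k) :
    ∑ x, f x = Fintype.card F * k + (f a - k) + (f b - k) := by
  classical
  have : ∀ x, f x = k + (if x = a then f a - k else 0) + (if x = b then f b - k else 0) :=
    fun x => by
    by_cases hx : x = a
    · subst hx; simp [hab]
    · by_cases hx' : x = b
      · subst hx'; simp [hx]
      · simp [hx, hx', h x hx hx']
  rw [Finset.sum_congr rfl fun x _ => this x, Finset.sum_add_distrib, Finset.sum_add_distrib]
  simp

theorem sum_off3 {F : Type*} [Fintype F] (f : F → ℤ) (a b c : F) (k : ℤ) (hab : a ≠ b)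
    (hac : a ≠ c) (hbc : b ≠ c) (h : ∀ x, x ≠ a → x ≠ b → x ≠ c → f x = k) :
    ∑ x, f x = Fintype.card F * k + (f a - k) + (f b - k) + (f c - k) := by
  classical
  have e := sum_off2 (fun x => f x - if x = c then f c - k else 0) a b k hab (fun x h1 h2 => by
    by_cases hx : x = c
    · subst hx; simp
    · simp [hx, h x h1 h2 hx])
  simp [hac, hbc] at e
  linarith

theorem sum_const0 {F : Type*} [Fintype F] (f : F → ℤ) (k : ℤ)
    (h : ∀ x, f x = k) : ∑ x, f x = Fintype.card F * k := by
  rw [Finset.sum_congr rfl fun x _ => h x]; simp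

variable {F : Type*} [Field F] [Fintype F]

open scoped Classical in
theorem card_IS : (Nat.card (IS F) : ℤ) =
    ((Fintype.card F : ℤ) - 1) ^ 2 + ((Fintype.card F : ℤ) - 2) := by
  rw [card_sub_eq]
  simp only [Fintype.sum_prod_type, Fintype.sum_bool, reduceCtorEq, forall_true_left,
    false_imp_iff, and_true]
  have h1 : (∑ a : F, ∑ b : F, if a ≠ 0 ∧ b ≠ 0 then (1 : ℤ) else 0) =
      ((Fintype.card F : ℤ) - 1) ^ 2 := by
    rw [sum_off1 _ 0 ((Fintype.card F : ℤ) - 1)]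
    · simp; ring
    · intro a ha
      rw [sum_off1 _ 0 1]
      · simp; ring
      · intro b hb; simp [ha, hb]
  have h2 : (∑ a : F, ∑ b : F, if a ≠ 0 ∧ b ≠ 0 ∧ a + b = 1 then (1 : ℤ) else 0) =
      ((Fintype.card F : ℤ) - 2) := by
    have inner : ∀ a : F, (∑ b : F, if a ≠ 0 ∧ b ≠ 0 ∧ a + b = 1 then (1 : ℤ) else 0) =
        if a ≠ 0 ∧ a ≠ 1 then 1 else 0 := by
      intro a
      rw [sum_off1 _ (1 - a) 0]
      · simp [sub_eq_zero, eq_comm (a := (1 : F))]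
      · intro b hb
        rw [if_neg]
        rintro ⟨-, -, h⟩
        exact hb (by linear_combination h)
    simp only [inner]
    rw [sum_off2 _ 0 1 1 (by simp)]
    · simp; ring
    · intro a h1 h2; simp [h1, h2]
  rw [h1, h2]; ring

open scoped Classical in
theorem card_IM : (Nat.card (IM F) : ℤ) =
    ((Fintype.card F : ℤ) - 1) ^ 2 * Fintype.card F
      + ((Fintype.card F : ℤ) - 2) * (Fintype.card F - 1) := by
  rw [card_sub_eq]
  simp only [Fintype.sum_prod_type, Fintype.sum_bool, reduceCtorEq, forall_true_left,
    false_imp_iff, and_true]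
  have h1 : (∑ a : F, ∑ t : F, ∑ b : F, if a ≠ 0 ∧ b ≠ 0 then (1 : ℤ) else 0) =
      ((Fintype.card F : ℤ) - 1) ^ 2 * Fintype.card F := by
    rw [sum_off1 _ 0 (((Fintype.card F : ℤ) - 1) * Fintype.card F)]
    · simp; ring
    · intro a ha
      rw [sum_const0 _ ((Fintype.card F : ℤ) - 1)]
      · ring
      intro t
      rw [sum_off1 _ 0 1]
      · simp; ring
      · intro b hb; simp [ha, hb]
  have h2 : (∑ a : F, ∑ t : F, ∑ d : F,
      if a ≠ 0 ∧ d ≠ 0 ∧ nrm t d (1 - a, -1) = 0 then (1 : ℤ) else 0) =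
      ((Fintype.card F : ℤ) - 2) * (Fintype.card F - 1) := by
    have inner : ∀ a t : F, (∑ d : F,
        if a ≠ 0 ∧ d ≠ 0 ∧ nrm t d (1 - a, -1) = 0 then (1 : ℤ) else 0) =
        if a ≠ 0 ∧ a ≠ 1 ∧ t ≠ 1 - a then 1 else 0 := by
      intro a t
      rw [sum_off1 _ ((1 - a) * (t - (1 - a))) 0]
      · have e : nrm t ((1 - a) * (t - (1 - a))) (1 - a, -1) = 0 := by simp only [nrm]; ring
        simp [e, sub_eq_zero, eq_comm (a := (1 : F))]
      · intro b hb
        rw [if_neg]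
        rintro ⟨-, -, h⟩
        simp only [nrm] at h
        exact hb (by linear_combination h)
    simp only [inner]
    rw [sum_off2 _ 0 1 ((Fintype.card F : ℤ) - 1) (by simp)]
    · simp; ring
    · intro a h1 h2
      rw [sum_off1 _ (1 - a) 1]
      · simp; ring
      · intro t ht; simp [h1, h2, ht]
  rw [h1, h2]; ring

open scoped Classical in
theorem card_N0 : (∑ x : F, ∑ y : F, ∑ t : F, ∑ d : F,
      if d ≠ 0 ∧ nrm t d (x, y) ≠ 0 then (1 : ℤ) else 0) =
      (Fintype.card F : ℤ) ^ 3 * (Fintype.card F - 1) - Fintype.card F * (Fintype.card F - 1)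
        - ((Fintype.card F : ℤ) - 1) ^ 3 := by
  set q : ℤ := ((Fintype.card F : ℕ) : ℤ) with hq
  have c1 : (∑ t : F, ∑ d : F,
      if d ≠ 0 ∧ nrm t d ((0, 0) : F × F) ≠ 0 then (1 : ℤ) else 0) = 0 := by simp [nrm]
  have c2 : ∀ x y : F, (x = 0 ∧ y ≠ 0) ∨ (x ≠ 0 ∧ y = 0) → (∑ t : F, ∑ d : F,
      if d ≠ 0 ∧ nrm t d (x, y) ≠ 0 then (1 : ℤ) else 0) = q * (q - 1) := by
    intro x y h
    rw [sum_const0 _ (q - 1)]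
    intro t
    rw [sum_off1 _ 0 1]
    · simp [hq]; ring
    · intro d hd
      rcases h with ⟨rfl, h⟩ | ⟨h, rfl⟩ <;> simp [nrm, h, hd]
  have c3 : ∀ x y : F, x ≠ 0 → y ≠ 0 → (∑ t : F, ∑ d : F,
      if d ≠ 0 ∧ nrm t d (x, y) ≠ 0 then (1 : ℤ) else 0) = (q - 1) ^ 2 := by
    intro x y hx hy
    have e : ∀ t d, nrm t d (x, y) = 0 ↔ d = -(x ^ 2 + x * y * t) / y ^ 2 := by
      intro t d
      simp only [nrm]
      rw [eq_div_iff (by positivity)]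
      constructor <;> intro h <;> linear_combination h
    rw [sum_off1 _ (-x / y) (q - 2)]
    · rw [sum_off1 _ 0 1]
      · simp [hq]; ring
      · intro d hd
        have : -(x ^ 2 + x * y * (-x / y)) / y ^ 2 = 0 := by field_simp; ring
        rw [if_pos]
        exact ⟨hd, by rw [ne_eq, e, this]; exact hd⟩
    · intro t ht
      have : (0 : F) ≠ -(x ^ 2 + x * y * t) / y ^ 2 := by
        intro h
        rw [eq_div_iff (by positivity)] at h
        apply ht
        rw [eq_div_iff hy]
        apply mul_left_cancel₀ hx
        linear_combination h
      rw [sum_off2 _ 0 (-(x ^ 2 + x * y * t) / y ^ 2) 1 this]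
      · simp [e, hq]; ring
      · intro d h1 h2
        rw [if_pos]
        exact ⟨h1, by rw [ne_eq, e]; exact h2⟩
  rw [sum_off1 _ 0 (q * (q - 1) ^ 2 + q * (q - 1) - (q - 1) ^ 2)]
  · rw [sum_off1 _ 0 (q * (q - 1))]
    · rw [c1]; ring
    · intro y hy; exact c2 0 y (.inl ⟨rfl, hy⟩)
  · intro x hx
    rw [sum_off1 _ 0 ((q - 1) ^ 2)]
    · rw [c2 x 0 (.inr ⟨hx, rfl⟩)]; ring
    · intro y hy; exact c3 x y hx hy

open scoped Classical in
theorem card_N1 : (∑ x : F, ∑ y : F, ∑ t : F, ∑ d : F,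
      if d ≠ 0 ∧ nrm t d (x, y) ≠ 0 ∧ nrm t d (1 - x, -1 - y) = 0 then (1 : ℤ) else 0) =
      ((Fintype.card F : ℤ) - 1) ^ 2 + (Fintype.card F - 2) * (Fintype.card F - 1)
        + (Fintype.card F - 2) * (((Fintype.card F : ℤ) - 2) ^ 2 + 1) := by
  set q : ℤ := ((Fintype.card F : ℕ) : ℤ) with hq
  set G : F → F → ℤ := fun x y => (∑ t : F, ∑ d : F,
      if d ≠ 0 ∧ nrm t d (x, y) ≠ 0 ∧ nrm t d (1 - x, -1 - y) = 0 then (1 : ℤ) else 0) with hG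
  change ∑ x, ∑ y, G x y = _
  have g1 : G 1 (-1) = (q - 1) ^ 2 := by
    simp only [hG]
    rw [sum_off1 _ 1 (q - 2)]
    · rw [sum_off1 _ 0 1]
      · simp [nrm, hq]; ring
      · intro d hd; simp [nrm, hd]
    · intro t ht
      rw [sum_off2 _ 0 (t - 1) 1 (by rw [ne_comm, ne_eq, sub_eq_zero]; exact ht)]
      · rw [if_neg, if_neg]
        · ring
        · rintro ⟨-, h, -⟩
          apply h; simp only [nrm]; ring
        · simp
      · intro d h1 h2
        rw [if_pos]
        refine ⟨h1, fun h => h2 ?_, by simp [nrm]⟩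
        simp only [nrm] at h
        linear_combination h
  have g2 : ∀ x, x ≠ 1 → G x (-1) = 0 := by
    intro x hx
    have : 1 - x ≠ 0 := by rw [sub_ne_zero]; exact hx.symm
    simp [hG, nrm, this]
  have g3 : ∀ y, y ≠ -1 → G 1 y = 0 := by
    intro y hy
    have : -1 - y ≠ 0 := by rw [sub_ne_zero]; exact hy.symm
    simp only [hG]
    refine Finset.sum_eq_zero fun t _ => Finset.sum_eq_zero fun d _ => if_neg ?_
    rintro ⟨h1, -, h2⟩
    simp [nrm, this, h1] at h2
  have g4 : ∀ x y, x ≠ 1 → y ≠ -1 → G x y = ∑ t, if t ≠ (1 - x) / (1 + y) ∧ x ≠ -y ∧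
      x * (1 + y) + y * (1 + y) * t - y * (1 - x) ≠ 0 then (1 : ℤ) else 0 := by
    intro x y hx hy
    have hx' : 1 - x ≠ 0 := by rw [sub_ne_zero]; exact hx.symm
    have hy' : 1 + y ≠ 0 := fun h => hy (by linear_combination h)
    simp only [hG]
    refine Finset.sum_congr rfl fun t _ => ?_
    have hd : ∀ d, nrm t d (1 - x, -1 - y) = 0 ↔
        d = (1 - x) * (t * (1 + y) - (1 - x)) / (1 + y) ^ 2 := by
      intro d
      simp only [nrm]
      rw [eq_div_iff (by positivity)]
      constructor <;> intro h <;> linear_combination h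
    set D := (1 - x) * (t * (1 + y) - (1 - x)) / (1 + y) ^ 2 with hD
    rw [sum_off1 _ D 0]
    · have e1 : D ≠ 0 ↔ t ≠ (1 - x) / (1 + y) := by
        rw [not_iff_not, eq_div_iff hy', hD, div_eq_zero_iff]
        simp [hx', hy', sub_eq_zero]
      have e2 : nrm t D (x, y) ≠ 0 ↔ x ≠ -y ∧
          x * (1 + y) + y * (1 + y) * t - y * (1 - x) ≠ 0 := by
        have : nrm t D (x, y) =
          (x + y) * (x * (1 + y) + y * (1 + y) * t - y * (1 - x)) / (1 + y) ^ 2 := by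
          simp only [nrm, hD]; field_simp; ring
        rw [this, div_ne_zero_iff, mul_ne_zero_iff]
        simp [hy', add_eq_zero_iff_eq_neg]
      simp only [e1, e2, hd]
      simp
    · intro d h
      rw [if_neg]
      rintro ⟨-, -, h'⟩
      exact h ((hd d).1 h')
  have g5 : ∀ y, y ≠ 0 → y ≠ -1 → G 0 y = q - 1 := by
    intro y h0 hy
    have hy' : 1 + y ≠ 0 := fun h => hy (by linear_combination h)
    rw [g4 0 y (by simp) hy, sum_off1 _ (1 / (1 + y)) 1]
    · simp [hq]; ring
    · intro t ht
      rw [if_pos]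
      refine ⟨by simpa using ht, by simpa [eq_comm] using h0, fun h => ht ?_⟩
      rw [eq_div_iff hy']
      apply mul_left_cancel₀ h0
      linear_combination h
  have g6 : ∀ x, x ≠ 0 → x ≠ 1 → G x 0 = q - 1 := by
    intro x h0 hx
    rw [g4 x 0 hx (by simp), sum_off1 _ (1 - x) 1]
    · simp [hq]; ring
    · intro t ht
      simp [ht, h0]
  have g7 : ∀ x, x ≠ 1 → G x (-x) = 0 := by
    intro x hx
    rw [g4 x (-x) hx (by simpa using hx)]
    simp
  have g8 : ∀ x y, x ≠ 0 → x ≠ 1 → y ≠ -1 → y ≠ -x → y ≠ 0 → G x y = q - 2 := by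
    intro x y h0 h1 hy hyx hy0
    have hy' : 1 + y ≠ 0 := fun h => hy (by linear_combination h)
    rw [g4 x y h1 hy, sum_off2 _ ((1 - x) / (1 + y)) ((y * (1 - x) - x * (1 + y)) / (y * (1 + y))) 1]
    · rw [if_neg, if_neg]
      · ring
      · rintro ⟨-, -, h⟩
        apply h; field_simp; ring
      · simp
    · intro h
      rw [div_eq_div_iff hy' (mul_ne_zero hy0 hy')] at h
      have : x * (1 + y) * (1 + y) = 0 := by linear_combination h
      simp [h0, hy'] at this
    · intro t h2 h3
      rw [if_pos]
      refine ⟨h2, fun h => hyx (by linear_combination h), fun h => h3 ?_⟩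
      rw [eq_div_iff (mul_ne_zero hy0 hy')]
      linear_combination h
  rw [sum_off2 _ 0 1 ((q - 2) ^ 2 + 1) (by simp)]
  · rw [sum_off2 _ 0 (-1) (q - 1) (by simp) (fun y h1 h2 => g5 y h1 h2)]
    rw [sum_off1 _ (-1) 0 g3, g1, g2 0 (by simp)]
    have := g7 0 (by simp)
    rw [neg_zero] at this
    rw [this]; ring
  · intro x h0 h1
    rw [sum_off3 _ (-1) (-x) 0 (q - 2) (by simpa [eq_comm] using h1) (by simp) (by simpa using h0)
      (fun y a b c => g8 x y h0 h1 a b c), g2 x h1, g6 x h0 h1, g7 x h1]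
    ring

open scoped Classical in
theorem card_N2 : (∑ l : F, ∑ x : F, ∑ y : F, ∑ t : F, ∑ d : F,
      if d ≠ 0 ∧ nrm t d (x, y) ≠ 0 ∧ ((1 - x, -1 - y) : F × F) = 0 ∧ l ^ 2 - t * l + d = 0
      then (1 : ℤ) else 0) = ((Fintype.card F : ℤ) - 2) ^ 2 := by
  set q : ℤ := ((Fintype.card F : ℕ) : ℤ) with hq
  have h1 : ∀ l : F, (∑ x : F, ∑ y : F, ∑ t : F, ∑ d : F,
      if d ≠ 0 ∧ nrm t d (x, y) ≠ 0 ∧ ((1 - x, -1 - y) : F × F) = 0 ∧ l ^ 2 - t * l + d = 0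
      then (1 : ℤ) else 0) = ∑ t : F, if (l ≠ 0 ∧ l ≠ 1) ∧ t ≠ l ∧ t ≠ 1 + l then 1 else 0 := by
    intro l
    rw [sum_off1 _ 1 0, sum_off1 _ (-1) 0]
    · simp only [mul_zero, zero_add, sub_zero]
      refine Finset.sum_congr rfl fun t _ => ?_
      rw [sum_off1 _ (l * (t - l)) 0]
      · have e1 : nrm t (l * (t - l)) ((1, -1) : F × F) = (1 - l) * (1 + l - t) := by
          simp only [nrm]; ring
        have e2 : l ^ 2 - t * l + l * (t - l) = 0 := by ring
        rw [e1, e2]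
        simp only [mul_zero, zero_add, sub_zero]
        congr 1
        simp [sub_eq_zero, eq_comm (a := (1 : F)), eq_comm (a := (1 : F) + l)]
        tauto
      · intro d hd
        rw [if_neg]
        rintro ⟨-, -, -, h⟩
        exact hd (by linear_combination h)
    · intro y hy
      refine Finset.sum_eq_zero fun t _ => Finset.sum_eq_zero fun d _ => if_neg ?_
      rintro ⟨-, -, h, -⟩
      have := congrArg Prod.snd h
      simp only [Prod.snd_zero] at this
      exact hy (by linear_combination -this)
    · intro x hx
      refine Finset.sum_eq_zero fun y _ => Finset.sum_eq_zero fun t _ =>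
        Finset.sum_eq_zero fun d _ => if_neg ?_
      rintro ⟨-, -, h, -⟩
      have := congrArg Prod.fst h
      simp only [Prod.fst_zero] at this
      exact hx (by linear_combination -this)
  simp only [h1]
  rw [sum_off2 _ 0 1 (q - 2) (by simp)]
  · simp; ring
  · intro l a b
    rw [sum_off2 _ l (1 + l) 1 (by simp)]
    · simp [hq]; ring
    · intro t c d
      simp [a, b, c, d]

theorem card_IN : (Nat.card (IN F) : ℤ) =
    ((Fintype.card F : ℤ) ^ 3 * (Fintype.card F - 1) - Fintype.card F * (Fintype.card F - 1)
        - ((Fintype.card F : ℤ) - 1) ^ 3)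
    + (((Fintype.card F : ℤ) - 1) ^ 2 + (Fintype.card F - 2) * (Fintype.card F - 1)
        + (Fintype.card F - 2) * (((Fintype.card F : ℤ) - 2) ^ 2 + 1))
    + ((Fintype.card F : ℤ) - 2) ^ 2 := by
  rw [card_sub_eq, ← card_N0, ← card_N1, ← card_N2]
  simp only [Fintype.sum_prod_type, Fintype.sum_option]
  rw [add_assoc]
  refine congrArg₂ _ ?_ (congrArg₂ _ ?_ ?_)
  · refine Finset.sum_congr rfl fun _ _ => Finset.sum_congr rfl fun _ _ =>
      Finset.sum_congr rfl fun _ _ => Finset.sum_congr rfl fun _ _ => ?_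
    exact @if_congr _ _ _ (_) (_) _ _ _ _ (by simp [okc]) rfl rfl
  · refine Finset.sum_congr rfl fun _ _ => Finset.sum_congr rfl fun _ _ =>
      Finset.sum_congr rfl fun _ _ => Finset.sum_congr rfl fun _ _ => ?_
    exact @if_congr _ _ _ (_) (_) _ _ _ _ (by simp [okc]) rfl rfl
  · refine Finset.sum_congr rfl fun _ _ => Finset.sum_congr rfl fun _ _ =>
      Finset.sum_congr rfl fun _ _ => Finset.sum_congr rfl fun _ _ =>
      Finset.sum_congr rfl fun _ _ => ?_
    exact @if_congr _ _ _ (_) (_) _ _ _ _ (by simp [okc]) rfl rfl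

end counting

/-- For every prime `p`, there are exactly `p^4 - p^2 - p - 1` medial quasigroups
admitting an affine form over `ℤ_p × ℤ_p`, up to isomorphism. -/
theorem mq_elementary_abelian_p_squared (p : ℕ) (hp : p.Prime) :
    (mqG (ZMod p × ZMod p) : ℤ) = (p : ℤ) ^ 4 - (p : ℤ) ^ 2 - (p : ℤ) - 1 := by

  have : Fact p.Prime := ⟨hp⟩
  have hF : ∀ (α : ZMod p × ZMod p ≃+ ZMod p × ZMod p) (c : ZMod p) x, α (c • x) = c • α x :=
    fun α c x => ZMod.map_smul α c x
  rw [card_quot hF, Nat.card_sum, Nat.card_sum]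
  push_cast
  rw [card_IS, card_IN, card_IM, ZMod.card]
  ring
end

section
/- For every prime p, the number of medial quasigroups of order p^2, counted up to isomorphism, is exactly 2p^4 - p^3 - p^2 - 3p - 1. -/
set_option linter.unusedSectionVars false


def HasCount {X : Type*} (r : X → X → Prop) (P : X → Prop) (n : ℕ) : Prop :=
  ∃ (T : Type) (_ : Finite T) (F : T → X), Nat.card T = n ∧ (∀ t, P (F t)) ∧
    (∀ t t', r (F t) (F t') → t = t') ∧ ∀ x, P x → ∃ t, r x (F t)

theorem HasCount.split {X : Type*} {r : X → X → Prop} {P : X → Prop} {n m : ℕ} (σ : X → Prop)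
    (hσ : ∀ x y, r x y → σ x → σ y) (hσ' : ∀ x y, r x y → ¬ σ x → ¬ σ y)
    (h1 : HasCount r (fun x => P x ∧ σ x) n) (h2 : HasCount r (fun x => P x ∧ ¬ σ x) m) :
    HasCount r P (n + m) := by
  obtain ⟨T, _, F, hT, hF1, hF2, hF3⟩ := h1
  obtain ⟨S, _, G, hS, hG1, hG2, hG3⟩ := h2
  refine ⟨T ⊕ S, inferInstance, Sum.elim F G, ?_, ?_, ?_, ?_⟩
  · rw [Nat.card_sum, hT, hS]
  · rintro (t | t)
    · exact (hF1 t).1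
    · exact (hG1 t).1
  · rintro (t | t) (t' | t') h
    · exact congrArg _ (hF2 _ _ h)
    · exact absurd (hσ _ _ h (hF1 t).2) (hG1 t').2
    · exact absurd (hF1 t').2 (hσ' _ _ h (hG1 t).2)
    · exact congrArg _ (hG2 _ _ h)
  · intro x hx
    by_cases h : σ x
    · obtain ⟨t, ht⟩ := hF3 x ⟨hx, h⟩
      exact ⟨Sum.inl t, ht⟩
    · obtain ⟨t, ht⟩ := hG3 x ⟨hx, h⟩
      exact ⟨Sum.inr t, ht⟩

theorem HasCount.card_quot {X : Type*} {r : X → X → Prop} {P : X → Prop} {n : ℕ}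
    (hr : Equivalence r) (h : HasCount r P n) :
    Nat.card (Quot fun (a b : {x // P x}) => r a.1 b.1) = n := by
  obtain ⟨T, _, F, hT, hF1, hF2, hF3⟩ := h
  rw [← hT]
  symm
  refine Nat.card_congr (Equiv.ofBijective (fun t => Quot.mk _ ⟨F t, hF1 t⟩) ⟨?_, ?_⟩)
  · intro t t' h
    have he : Equivalence (fun (a b : {x // P x}) => r a.1 b.1) :=
      ⟨fun a => hr.refl _, fun h => hr.symm h, fun h h' => hr.trans h h'⟩
    have := Quot.eqvGen_exact h
    rw [he.eqvGen_iff] at this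
    exact hF2 _ _ this
  · intro q
    induction q using Quot.ind with
    | mk a =>
      obtain ⟨t, ht⟩ := hF3 a.1 a.2
      exact ⟨t, (Quot.sound (r := fun (a b : {x // P x}) => r a.1 b.1) (a := a) (b := ⟨F t, hF1 t⟩) ht).symm⟩

theorem QuasigroupIso.refl {Q : Type*} (o : Q → Q → Q) : QuasigroupIso o o :=
  ⟨Equiv.refl _, fun _ _ => rfl⟩

theorem QuasigroupIso.symm {Q Q' : Type*} {o : Q → Q → Q} {o' : Q' → Q' → Q'}
    (h : QuasigroupIso o o') : QuasigroupIso o' o := by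
  obtain ⟨f, hf⟩ := h
  refine ⟨f.symm, fun x y => ?_⟩
  apply f.injective
  rw [hf]; simp

theorem QuasigroupIso.trans {Q Q' Q'' : Type*} {o : Q → Q → Q} {o' : Q' → Q' → Q'}
    {o'' : Q'' → Q'' → Q''}
    (h : QuasigroupIso o o') (h' : QuasigroupIso o' o'') : QuasigroupIso o o'' := by
  obtain ⟨f, hf⟩ := h
  obtain ⟨g, hg⟩ := h'
  exact ⟨f.trans g, fun x y => by simp [hf, hg]⟩

theorem IsQuasigroup.of_iso {Q Q' : Type*} {o : Q → Q → Q} {o' : Q' → Q' → Q'}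
    (h : QuasigroupIso o o') (hq : IsQuasigroup o') : IsQuasigroup o := by
  obtain ⟨f, hf⟩ := h
  constructor
  · intro a
    have : (fun x => o a x) = f.symm ∘ (fun x => o' (f a) x) ∘ f := by
      funext x; simp [← hf]
    rw [this]
    exact f.symm.bijective.comp ((hq.1 _).comp f.bijective)
  · intro a
    have : (fun x => o x a) = f.symm ∘ (fun x => o' x (f a)) ∘ f := by
      funext x; simp [← hf]
    rw [this]
    exact f.symm.bijective.comp ((hq.2 _).comp f.bijective)

theorem IsMedial.of_iso {Q Q' : Type*} {o : Q → Q → Q} {o' : Q' → Q' → Q'}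
    (h : QuasigroupIso o o') (hq : IsMedial o') : IsMedial o := by
  obtain ⟨f, hf⟩ := h
  intro x y u v
  apply f.injective
  simp only [hf]
  exact hq _ _ _ _

/-- Toyoda's theorem. -/
theorem toyoda {Q : Type*} [Nonempty Q] (o : Q → Q → Q) (hq : IsQuasigroup o) (hm : IsMedial o) :
    ∃ (_ : AddCommGroup Q) (φ ψ : Q ≃+ Q) (c : Q), (∀ x y, o x y = φ x + ψ y + c) ∧
      ∀ x, φ (ψ x) = ψ (φ x) := by
  obtain ⟨e⟩ := ‹Nonempty Q›
  let α : Q ≃ Q := Equiv.ofBijective _ (hq.2 e)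
  let β : Q ≃ Q := Equiv.ofBijective _ (hq.1 e)
  let ad : Q → Q → Q := fun x y => o (α.symm x) (β.symm y)
  let z := o e e
  have hα : α e = z := rfl
  have hβ : β e = z := rfl
  have ho : ∀ x y, o x y = ad (α x) (β y) := fun x y => by simp [ad]
  have zad : ∀ y, ad z y = y := fun y => by
    have : α.symm z = e := by rw [← hα]; simp
    simp only [ad, this]
    exact β.apply_symm_apply y
  have adz : ∀ y, ad y z = y := fun y => by
    have : β.symm z = e := by rw [← hβ]; simp
    simp only [ad, this]
    exact α.apply_symm_apply y
  have canl : ∀ a x y, ad a x = ad a y → x = y := fun a x y h =>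
    β.symm.injective ((hq.1 _).1 h)
  have med : ∀ x y u v, ad (α (ad (α x) (β y))) (β (ad (α u) (β v))) =
      ad (α (ad (α x) (β u))) (β (ad (α y) (β v))) := by
    intro x y u v
    simp only [← ho]
    exact hm x y u v
  let γ : Q → Q := fun p => α (β (α.symm p))
  have e1 : ∀ p q r, ad (γ p) (β (ad q r)) = ad (γ q) (β (ad p r)) := by
    intro p q r
    have := med e (α.symm p) (α.symm q) (β.symm r)
    simpa [hα, zad, γ] using this
  have γz : γ z = α z := by simp [γ, ← hα]; rw [hα, hβ]
  have e2 : ∀ p q, ad (α z) (β (ad p q)) = ad (γ p) (β q) := by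
    intro p q
    rw [← γz, e1, zad]
  have comm : ∀ p q, ad p q = ad q p := by
    intro p q
    apply β.injective
    apply canl (α z)
    have := e1 p q z
    rw [adz, adz] at this
    rw [e2, e2, this]
  have lc : ∀ p q r, ad p (ad q r) = ad q (ad p r) := by
    intro p q r
    apply β.injective
    apply canl (α z)
    rw [e2, e2, e1]
  have assoc : ∀ p q r, ad (ad p q) r = ad p (ad q r) := by
    intro p q r
    rw [comm (ad p q), lc, comm r q]
  have exneg : ∀ x, ∃ y, ad x y = z := fun x => by
    obtain ⟨w, hw⟩ := (hq.1 (α.symm x)).2 z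
    exact ⟨β w, by simpa [ad] using hw⟩
  choose ng hng using exneg
  let i1 : Add Q := ⟨ad⟩
  let i2 : Zero Q := ⟨z⟩
  let i3 : Neg Q := ⟨ng⟩
  let inst : AddCommGroup Q :=
    { add := ad, zero := z, neg := ng, add_assoc := assoc, zero_add := zad, add_zero := adz,
      add_comm := comm, neg_add_cancel := fun a => (comm _ _).trans (hng a),
      nsmul := nsmulRec, zsmul := zsmulRec }
  have hadd : ∀ x y, ad x y = x + y := fun _ _ => rfl
  have hz : z = 0 := rfl
  simp only [hadd, hz] at *
  have hβadd : ∀ p q, β (p + q) = β p + β q - β 0 := by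
    intro p q
    have h1 := e2 p q
    have h2 := e2 p 0
    rw [add_zero] at h2
    have h3 : γ p = α 0 + β p - β 0 := by rw [h2]; abel
    rw [h3] at h1
    have : β (p + q) = (α 0 + β p - β 0 + β q) - α 0 := by rw [← h1]; abel
    rw [this]; abel
  have e3 : ∀ p q, α (p + q) + β 0 = α p + β (α (β.symm q)) := by
    intro p q
    have := med (α.symm p) (β.symm q) e e
    simpa [hα, hβ] using this
  have hαadd : ∀ p q, α (p + q) = α p + α q - α 0 := by
    intro p q
    have h1 := e3 p q
    have h2 := e3 0 q
    rw [zero_add] at h2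
    have h3 : β (α (β.symm q)) = α q + β 0 - α 0 := by rw [h2]; abel
    rw [h3] at h1
    have : α (p + q) = (α p + (α q + β 0 - α 0)) - β 0 := by rw [← h1]; abel
    rw [this]; abel
  let φ : Q ≃+ Q := AddEquiv.mk' (α.trans (Equiv.subRight (α 0)))
    (fun x y => by simp [hαadd]; abel)
  let ψ : Q ≃+ Q := AddEquiv.mk' (β.trans (Equiv.subRight (β 0)))
    (fun x y => by simp [hβadd]; abel)
  have hφ : ∀ x, φ x = α x - α 0 := fun _ => rfl
  have hψ : ∀ x, ψ x = β x - β 0 := fun _ => rfl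
  have hop : ∀ x y, o x y = φ x + ψ y + (α 0 + β 0) := by
    intro x y
    rw [ho, hφ, hψ]; abel
  refine ⟨inst, φ, ψ, α 0 + β 0, hop, ?_⟩
  intro x
  have h1 := hm 0 x 0 0
  simp only [hop, map_add, map_zero] at h1
  have : φ (ψ x) - ψ (φ x) = 0 := by
    rw [← sub_eq_zero] at h1
    rw [← h1]; abel
  exact sub_eq_zero.mp this


structure Tri (R M : Type) [CommRing R] [AddCommGroup M] [Module R M] where
  A : M →ₗ[R] M
  B : M →ₗ[R] M
  c : M

namespace Tri

section
variable {R M : Type} [CommRing R] [AddCommGroup M] [Module R M]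

def op (τ : Tri R M) (x y : M) : M := τ.A x + τ.B y + τ.c

def Valid (τ : Tri R M) : Prop :=
  Function.Bijective τ.A ∧ Function.Bijective τ.B ∧ ∀ x, τ.A (τ.B x) = τ.B (τ.A x)

def rel (τ τ' : Tri R M) : Prop :=
  ∃ (g : M ≃ₗ[R] M) (t : M), (∀ x, g (τ'.A x) = τ.A (g x)) ∧ (∀ x, g (τ'.B x) = τ.B (g x)) ∧
    g τ'.c = τ.c + (t - τ.A t - τ.B t)

theorem Valid.isQuasigroup {τ : Tri R M} (h : τ.Valid) : IsQuasigroup τ.op := by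
  constructor
  · intro a
    have : (fun x => τ.op a x) = (Equiv.addLeft (τ.A a + τ.c)) ∘ τ.B := by
      funext x; simp [op]; abel
    rw [this]
    exact (Equiv.bijective _).comp h.2.1
  · intro a
    have : (fun x => τ.op x a) = (Equiv.addLeft (τ.B a + τ.c)) ∘ τ.A := by
      funext x; simp [op]; abel
    rw [this]
    exact (Equiv.bijective _).comp h.1

theorem Valid.isMedial {τ : Tri R M} (h : τ.Valid) : IsMedial τ.op := by
  intro x y u v
  simp only [op, map_add, h.2.2]
  abel

end
end Tri

theorem affine_of_iso {G H : Type} [AddCommGroup G] [AddCommGroup H] (A B : G →+ G) (c : G)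
    (A' B' : H →+ H) (c' : H) (hA : Function.Surjective A) (hB : Function.Surjective B)
    (h : G ≃ H) (hh : ∀ x y, h (A x + B y + c) = A' (h x) + B' (h y) + c') :
    ∃ g : G ≃+ H, ∀ x, g x = h x - h 0 := by
  have key : ∀ u v, h (u + v) = h u + h v - h 0 := by
    intro u v
    obtain ⟨x, hx⟩ := hA (u - c)
    obtain ⟨x0, hx0⟩ := hA (0 - c)
    obtain ⟨y, rfl⟩ := hB v
    have h1 := hh x y
    have h2 := hh x 0
    have h3 := hh x0 y
    have h4 := hh x0 0
    rw [hx] at h1 h2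
    rw [hx0] at h3 h4
    have e1 : u - c + B y + c = u + B y := by abel
    have e2 : u - c + B 0 + c = u := by simp
    have e3 : 0 - c + B y + c = B y := by abel
    have e4 : 0 - c + B 0 + c = 0 := by simp
    rw [e1] at h1
    rw [e2] at h2
    rw [e3] at h3
    rw [e4] at h4
    rw [h1, h2, h3]
    generalize h 0 = w at *
    rw [eq_sub_iff_add_eq]
    nth_rewrite 1 [h4]
    abel
  exact ⟨AddEquiv.mk' (h.trans (Equiv.subRight (h 0))) (fun x y => by simp [key]; abel),
    fun _ => rfl⟩

theorem Tri.rel_of_iso {n : ℕ} {M : Type} [AddCommGroup M] [Module (ZMod n) M]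
    {τ τ' : Tri (ZMod n) M} (hτ' : τ'.Valid) (h : QuasigroupIso τ.op τ'.op) : τ.rel τ' := by
  obtain ⟨h, hh⟩ := h.symm
  obtain ⟨g, hg⟩ := affine_of_iso τ'.A.toAddMonoidHom τ'.B.toAddMonoidHom τ'.c
    τ.A.toAddMonoidHom τ.B.toAddMonoidHom τ.c hτ'.1.2 hτ'.2.1.2 h hh
  obtain ⟨s, hs⟩ : ∃ s, s = h 0 := ⟨_, rfl⟩
  have hg' : ∀ x, h x = g x + s := fun x => by rw [hg, hs]; abel
  have hh' : ∀ x y, h (τ'.A x + τ'.B y + τ'.c) = τ.A (h x) + τ.B (h y) + τ.c := hh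
  simp only [hg', map_add] at hh'
  have h00 := hh' 0 0
  simp only [map_zero, zero_add] at h00
  have hx : ∀ x, g (τ'.A x) = τ.A (g x) := by
    intro x
    have := hh' x 0
    simp only [map_zero, zero_add, add_zero] at this
    have e := congrArg₂ (· - ·) this h00
    rw [← sub_eq_zero] at e ⊢
    rw [← e]; abel
  have hy : ∀ x, g (τ'.B x) = τ.B (g x) := by
    intro x
    have := hh' 0 x
    simp only [map_zero, zero_add, add_zero] at this
    have e := congrArg₂ (· - ·) this h00
    rw [← sub_eq_zero] at e ⊢
    rw [← e]; abel
  refine ⟨{ g with map_smul' := fun r x => (ZMod.map_smul g r x) }, - s, hx, hy, ?_⟩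
  change g τ'.c = _
  rw [map_neg, map_neg]
  rw [← sub_eq_zero] at h00 ⊢
  rw [← h00]; abel

theorem Tri.iso_of_rel {R M : Type} [CommRing R] [AddCommGroup M] [Module R M]
    {τ τ' : Tri R M} (h : τ.rel τ') : QuasigroupIso τ.op τ'.op := by
  obtain ⟨g, t, h1, h2, h3⟩ := h
  apply QuasigroupIso.symm
  refine ⟨g.toEquiv.trans (Equiv.addRight (-t)), fun x y => ?_⟩
  simp only [Tri.op, Equiv.trans_apply, LinearEquiv.coe_toEquiv, Equiv.coe_addRight, map_add, h1, h2, h3, map_neg]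
  abel

theorem HasCount.congr {X : Type*} {r : X → X → Prop} {P P' : X → Prop} {n : ℕ}
    (h : HasCount r P n) (hP : ∀ x, P x ↔ P' x) : HasCount r P' n := by
  have : P = P' := funext fun x => propext (hP x)
  rwa [← this]

theorem HasCount.transfer {n N m : ℕ} {M : Type} [AddCommGroup M] [Module (ZMod n) M]
    (e : Fin N ≃ M) (h : HasCount (Tri.rel (R := ZMod n) (M := M)) Tri.Valid m) :
    HasCount (QuasigroupIso (Q₁ := Fin N) (Q₂ := Fin N))
      (fun o => ∃ τ : Tri (ZMod n) M, τ.Valid ∧ QuasigroupIso o τ.op) m := by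
  obtain ⟨T, hTf, F, hT, hF1, hF2, hF3⟩ := h
  have key : ∀ τ : Tri (ZMod n) M, QuasigroupIso (fun x y => e.symm (τ.op (e x) (e y))) τ.op :=
    fun τ => ⟨e, fun x y => by simp⟩
  refine ⟨T, hTf, fun t x y => e.symm ((F t).op (e x) (e y)), hT, ?_, ?_, ?_⟩
  · intro t
    exact ⟨F t, hF1 t, key _⟩
  · intro t t' h
    apply hF2
    exact Tri.rel_of_iso (hF1 t') ((key _).symm.trans (h.trans (key _)))
  · rintro o ⟨τ, hτ, ho⟩
    obtain ⟨t, ht⟩ := hF3 τ hτ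
    exact ⟨t, ho.trans ((Tri.iso_of_rel ht).trans (key _).symm)⟩

/-- transport along an additive equivalence -/
theorem exists_tri {Q : Type*} [AddCommGroup Q] {n : ℕ} {M : Type} [AddCommGroup M]
    [Module (ZMod n) M] (o : Q → Q → Q) (φ ψ : Q ≃+ Q) (c : Q)
    (ho : ∀ x y, o x y = φ x + ψ y + c) (hc : ∀ x, φ (ψ x) = ψ (φ x)) (e : Q ≃+ M) :
    ∃ τ : Tri (ZMod n) M, τ.Valid ∧ QuasigroupIso o τ.op := by
  let a : M ≃+ M := (e.symm.trans φ).trans e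
  let b : M ≃+ M := (e.symm.trans ψ).trans e
  refine ⟨⟨{ a with map_smul' := fun r x => (ZMod.map_smul a r x) },
    { b with map_smul' := fun r x => (ZMod.map_smul b r x) }, e c⟩, ⟨a.bijective, b.bijective, ?_⟩,
    e.toEquiv, ?_⟩
  · intro x
    simp [a, b, hc]
  · intro x y
    simp [a, b, Tri.op, ho]

theorem group_exp_p_aux {p : ℕ} [Fact p.Prime] (Q : Type*) [AddCommGroup Q] [Finite Q]
    [Module (ZMod p) Q] (hQ : Nat.card Q = p ^ 2) : Nonempty (Q ≃+ ZMod p × ZMod p) := by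
  have hp : p.Prime := Fact.out
  have : Module.Finite (ZMod p) Q := Module.Finite.of_finite
  have hf : Module.finrank (ZMod p) Q = 2 := by
    have := Module.natCard_eq_pow_finrank (K := ZMod p) (V := Q)
    rw [hQ, Nat.card_zmod] at this
    exact (Nat.pow_right_injective hp.two_le this).symm
  exact ⟨(LinearEquiv.ofFinrankEq (R := ZMod p) Q (ZMod p × ZMod p)
    (by rw [hf]; simp)).toAddEquiv⟩

theorem group_exp_p {p : ℕ} (hp : p.Prime) (Q : Type*) [AddCommGroup Q] [Finite Q]
    (hQ : Nat.card Q = p ^ 2) (hx : ∀ x : Q, p • x = 0) : Nonempty (Q ≃+ ZMod p × ZMod p) := by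
  have : Fact p.Prime := ⟨hp⟩
  let _ : Module (ZMod p) Q := AddCommGroup.zmodModule hx
  exact group_exp_p_aux Q hQ

theorem group_order_p_sq {p : ℕ} (hp : p.Prime) (Q : Type*) [AddCommGroup Q] 
    (hQ : Nat.card Q = p ^ 2) :
    Nonempty (Q ≃+ ZMod (p ^ 2)) ∨ Nonempty (Q ≃+ ZMod p × ZMod p) := by
  have : Fact p.Prime := ⟨hp⟩
  have : Finite Q := Nat.finite_of_card_ne_zero (by rw [hQ]; exact pow_ne_zero _ hp.ne_zero)
  by_cases h : ∃ x : Q, addOrderOf x = p ^ 2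
  · left
    obtain ⟨x, hx⟩ := h
    have : IsAddCyclic Q := isAddCyclic_of_addOrderOf_eq_card x (by rw [hx, hQ])
    rw [← hQ]
    exact ⟨(zmodAddCyclicAddEquiv this).symm⟩
  · right
    push Not at h
    have hx : ∀ x : Q, p • x = 0 := by
      intro x
      have h1 : addOrderOf x ∣ p ^ 2 := hQ ▸ addOrderOf_dvd_natCard x
      obtain ⟨k, hk, hk'⟩ := (Nat.dvd_prime_pow hp).1 h1
      have : k ≠ 2 := fun h2 => h x (by rw [hk', h2])
      rw [← addOrderOf_dvd_iff_nsmul_eq_zero, hk']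
      exact (pow_dvd_pow p (show k ≤ 1 by omega)).trans (by simp)
    exact group_exp_p hp Q hQ hx

theorem mq_of_counts {p : ℕ} (hp : p.Prime) {n m : ℕ}
    (h1 : HasCount (Tri.rel (R := ZMod (p ^ 2)) (M := ZMod (p ^ 2))) Tri.Valid n)
    (h2 : HasCount (Tri.rel (R := ZMod p) (M := ZMod p × ZMod p)) Tri.Valid m) :
    mqN (p ^ 2) = n + m := by
  have : Fact p.Prime := ⟨hp⟩
  have : NeZero (p ^ 2) := ⟨pow_ne_zero _ hp.ne_zero⟩
  have e1 : Fin (p ^ 2) ≃ ZMod (p ^ 2) := Classical.choice (Finite.card_eq.1 <| by simp)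
  have e2 : Fin (p ^ 2) ≃ ZMod p × ZMod p := Classical.choice (Finite.card_eq.1 <| by simp [sq])
  have g1 := h1.transfer e1
  have g2 := h2.transfer e2
  refine HasCount.card_quot ⟨QuasigroupIso.refl, QuasigroupIso.symm, QuasigroupIso.trans⟩ ?_
  refine HasCount.split (fun o => ∃ τ : Tri (ZMod (p ^ 2)) (ZMod (p ^ 2)),
    τ.Valid ∧ QuasigroupIso o τ.op) ?_ ?_ (g1.congr ?_) (g2.congr ?_)
  · rintro x y h ⟨τ, hτ, h'⟩
    exact ⟨τ, hτ, h.symm.trans h'⟩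
  · rintro x y h h'' ⟨τ, hτ, h'⟩
    exact h'' ⟨τ, hτ, h.trans h'⟩
  · intro o
    refine ⟨fun h => ⟨?_, h⟩, fun h => h.2⟩
    obtain ⟨τ, hτ, h⟩ := h
    exact ⟨hτ.isQuasigroup.of_iso h, hτ.isMedial.of_iso h⟩
  · intro o
    constructor
    · rintro ⟨τ, hτ, h⟩
      refine ⟨⟨hτ.isQuasigroup.of_iso h, hτ.isMedial.of_iso h⟩, ?_⟩
      rintro ⟨τ', hτ', h'⟩
      obtain ⟨f, hf⟩ := h.symm.trans h'
      obtain ⟨g, -⟩ := affine_of_iso τ.A.toAddMonoidHom τ.B.toAddMonoidHom τ.c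
        τ'.A.toAddMonoidHom τ'.B.toAddMonoidHom τ'.c hτ.1.2 hτ.2.1.2 f hf
      have : g.symm (p • (1 : ZMod (p ^ 2))) = 0 := by
        rw [map_nsmul]
        ext <;> simp
      rw [g.symm.map_eq_zero_iff] at this
      simp only [nsmul_eq_mul, mul_one] at this
      rw [ZMod.natCast_eq_zero_iff] at this
      have := Nat.le_of_dvd hp.pos this
      nlinarith [hp.two_le]
    · rintro ⟨⟨hq, hm⟩, hn⟩
      obtain ⟨inst, φ, ψ, c, ho, hc⟩ := toyoda o hq hm
      rcases group_order_p_sq hp (Fin (p ^ 2)) (by simp) with h | h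
      · exact absurd (exists_tri o φ ψ c ho hc h.some) hn
      · exact exists_tri o φ ψ c ho hc h.some


section counting

theorem card_pull {X Y Z : Type} (f : X → Y) (e : X ≃ Y × Z)
    (he : ∀ x, (e x).1 = f x) (P : Y → Prop) :
    Nat.card {x // P (f x)} = Nat.card {y // P y} * Nat.card Z := by
  rw [← Nat.card_prod]
  refine Nat.card_congr ⟨fun x => (⟨f x.1, x.2⟩, (e x.1).2),
    fun y => ⟨e.symm (y.1.1, y.2), ?_⟩, ?_, ?_⟩
  · rw [← he]; simpa using y.1.2
  · rintro ⟨x, hx⟩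
    ext
    simp [← he]
  · rintro ⟨⟨y, hy⟩, z⟩
    ext <;> simp [← he]

theorem card_fib {X Y : Type} (P : X → Y → Prop) (Q : X → Prop) (m : ℕ)
    (h1 : ∀ x y, P x y → Q x) (h2 : ∀ x, Q x → Nat.card {y // P x y} = m) [Finite X] [Finite Y] :
    Nat.card {q : X × Y // P q.1 q.2} = Nat.card {x // Q x} * m := by
  have : {q : X × Y // P q.1 q.2} ≃ Σ x : {x // Q x}, {y // P x.1 y} :=
    ⟨fun q => ⟨⟨q.1.1, h1 _ _ q.2⟩, ⟨q.1.2, q.2⟩⟩, fun s => ⟨(s.1.1, s.2.1), s.2.2⟩,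
      fun _ => rfl, fun _ => rfl⟩
  rw [Nat.card_congr this]
  have := Fintype.ofFinite {x // Q x}
  rw [Nat.card_sigma, Finset.sum_congr rfl (fun x _ => h2 x.1 x.2)]
  simp

theorem card_split {X : Type} [Finite X] (P Q : X → Prop) :
    Nat.card {x // P x} = Nat.card {x // P x ∧ Q x} + Nat.card {x // P x ∧ ¬ Q x} := by
  classical
  rw [← Nat.card_sum]
  refine Nat.card_congr ⟨fun x => if h : Q x.1 then Sum.inl ⟨x.1, x.2, h⟩ else
    Sum.inr ⟨x.1, x.2, h⟩, fun s => s.elim (fun y => ⟨y.1, y.2.1⟩) (fun y => ⟨y.1, y.2.1⟩), ?_, ?_⟩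
  · intro x
    by_cases h : Q x.1 <;> simp [h]
  · rintro (⟨y, hy⟩ | ⟨y, hy⟩) <;> simp [hy.2]

theorem card_iff {X : Type} {P Q : X → Prop} (h : ∀ x, P x ↔ Q x) :
    Nat.card {x // P x} = Nat.card {x // Q x} := by
  have : P = Q := funext fun x => propext (h x)
  rw [this]

variable {p : ℕ} [Fact p.Prime]

theorem card_all : Nat.card {_x : ZMod p // True} = p := by
  rw [Nat.card_congr (Equiv.subtypeUnivEquiv (fun _ => trivial)), Nat.card_zmod]

theorem card_one (a : ZMod p) : Nat.card {x : ZMod p // x = a} = 1 := by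
  simp

theorem card_ne (a : ZMod p) : Nat.card {x : ZMod p // x ≠ a} = p - 1 := by
  have := card_split (X := ZMod p) (fun _ => True) (fun x => x = a)
  rw [card_all] at this
  simp only [true_and] at this
  rw [card_one] at this
  change p = 1 + Nat.card {x : ZMod p // x ≠ a} at this
  omega

theorem card_ne_ne (a b : ZMod p) (hab : a ≠ b) :
    Nat.card {x : ZMod p // x ≠ a ∧ x ≠ b} = p - 2 := by
  have := card_split (X := ZMod p) (fun x => x ≠ a) (fun x => x = b)
  rw [card_ne] at this
  have h1 : Nat.card {x : ZMod p // x ≠ a ∧ x = b} = 1 := by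
    rw [← card_one b]
    exact card_iff fun x => ⟨fun h => h.2, fun h => ⟨by rw [h]; exact hab.symm, h⟩⟩
  rw [h1] at this
  change p - 1 = 1 + Nat.card {x : ZMod p // x ≠ a ∧ x ≠ b} at this
  omega

theorem card_ne_prod : Nat.card {q : ZMod p × ZMod p // q.1 ≠ 0 ∧ q.2 ≠ 0} = (p - 1) * (p - 1) := by
  rw [card_fib (fun x y : ZMod p => x ≠ 0 ∧ y ≠ 0) (fun x => x ≠ 0) (p - 1) (fun x y h => h.1),
    card_ne]
  intro x hx
  rw [← card_ne (0 : ZMod p)]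
  exact card_iff fun y => by simp [hx]

theorem card_ne_one : Nat.card {x : ZMod p // x ≠ 0 ∧ 1 - x ≠ 0} = p - 2 := by
  rw [← card_ne_ne (0 : ZMod p) 1 zero_ne_one]
  refine card_iff fun x => ?_
  rw [sub_ne_zero, ne_comm (a := 1)]

theorem card_sum_one : Nat.card {q : ZMod p × ZMod p // q.1 ≠ 0 ∧ q.2 ≠ 0 ∧ 1 - q.1 - q.2 = 0} =
    p - 2 := by
  rw [card_fib (fun x y : ZMod p => x ≠ 0 ∧ y ≠ 0 ∧ 1 - x - y = 0)
    (fun x => x ≠ 0 ∧ 1 - x ≠ 0) 1, card_ne_one, mul_one]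
  · rintro x y ⟨h1, h2, h3⟩
    refine ⟨h1, ?_⟩
    rw [sub_eq_zero] at h3
    rwa [h3]
  · rintro x ⟨h1, h2⟩
    rw [← card_one (1 - x)]
    refine card_iff fun y => ⟨fun h => (sub_eq_zero.1 h.2.2).symm, fun h => ⟨h1, ?_, ?_⟩⟩
    · rwa [h]
    · rw [h, sub_self]

end counting

namespace Tri
variable {R M : Type} [CommRing R] [AddCommGroup M] [Module R M]

theorem rel.symm {τ τ' : Tri R M} (h : τ.rel τ') : τ'.rel τ := by
  obtain ⟨g, t, h1, h2, h3⟩ := h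
  have h1' : ∀ x, g.symm (τ.A x) = τ'.A (g.symm x) := fun x => by
    apply g.injective; rw [h1]; simp
  have h2' : ∀ x, g.symm (τ.B x) = τ'.B (g.symm x) := fun x => by
    apply g.injective; rw [h2]; simp
  refine ⟨g.symm, - g.symm t, h1', h2', ?_⟩
  have : g.symm (g τ'.c) = _ := congrArg g.symm h3
  simp only [LinearEquiv.symm_apply_apply, map_add, map_sub, h1', h2'] at this
  rw [this]
  simp only [map_neg]
  abel

def Ext (τ : Tri R M) : Prop := ∀ s, s - τ.A s - τ.B s ≠ τ.c

theorem rel.ext {τ τ' : Tri R M} (h : τ.rel τ') (hE : τ.Ext) : τ'.Ext := by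
  obtain ⟨g, t, h1, h2, h3⟩ := h
  intro s hs
  rw [← hs] at h3
  simp only [map_sub, h1, h2] at h3
  apply hE (g s - t)
  simp only [map_sub]
  rw [← sub_eq_zero] at h3 ⊢
  rw [← h3]; abel

def CZero (τ : Tri R M) : Prop := ∀ s, s - τ.A s - τ.B s = 0

theorem rel.cZero {τ τ' : Tri R M} (h : τ.rel τ') (hE : τ.CZero) : τ'.CZero := by
  obtain ⟨g, t, h1, h2, h3⟩ := h
  intro s
  apply g.injective
  simp only [map_sub, h1, h2, map_zero]
  exact hE _

theorem _root_.HasCount.split' {P : Tri R M → Prop} {n m : ℕ} (σ : Tri R M → Prop)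
    (hσ : ∀ x y : Tri R M, x.rel y → σ x → σ y)
    (h1 : HasCount rel (fun x => P x ∧ σ x) n) (h2 : HasCount rel (fun x => P x ∧ ¬ σ x) m) :
    HasCount rel P (n + m) :=
  HasCount.split σ hσ (fun x y h hx hy => hx (hσ y x h.symm hy)) h1 h2

end Tri

section psq
variable {p : ℕ} [hpf : Fact p.Prime]

theorem red_eq_zero_iff (x : ZMod (p ^ 2)) :
    ZMod.castHom (dvd_pow_self p two_ne_zero) (ZMod p) x = 0 ↔ ∃ k : ZMod (p ^ 2), x = (p : ZMod (p ^ 2)) * k := by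
  have : NeZero (p ^ 2) := ⟨pow_ne_zero _ hpf.out.ne_zero⟩
  constructor
  · intro h
    obtain ⟨n, rfl⟩ := ZMod.natCast_zmod_surjective x
    rw [map_natCast, ZMod.natCast_eq_zero_iff] at h
    obtain ⟨k, rfl⟩ := h
    exact ⟨k, by push_cast; rfl⟩
  · rintro ⟨k, rfl⟩
    rw [map_mul, map_natCast]; simp

theorem isUnit_iff_red (x : ZMod (p ^ 2)) :
    IsUnit x ↔ ZMod.castHom (dvd_pow_self p two_ne_zero) (ZMod p) x ≠ 0 := by
  have : NeZero (p ^ 2) := ⟨pow_ne_zero _ hpf.out.ne_zero⟩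
  obtain ⟨n, rfl⟩ := ZMod.natCast_zmod_surjective x
  rw [ZMod.isUnit_iff_coprime, map_natCast, Ne, ZMod.natCast_eq_zero_iff,
    Nat.coprime_pow_right_iff two_pos, Nat.coprime_comm, hpf.out.coprime_iff_not_dvd]

theorem not_isUnit_iff (x : ZMod (p ^ 2)) : ¬ IsUnit x ↔ ∃ k : ZMod (p ^ 2), x = (p : ZMod (p ^ 2)) * k := by
  rw [isUnit_iff_red, not_not, red_eq_zero_iff]

theorem p_mul_p : (p : ZMod (p ^ 2)) * p = 0 := by
  have : ((p ^ 2 : ℕ) : ZMod (p ^ 2)) = 0 := ZMod.natCast_self _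
  push_cast at this
  rw [← sq, this]

theorem p_ne : (p : ZMod (p ^ 2)) ≠ 0 := by
  rw [Ne, ZMod.natCast_eq_zero_iff]
  intro h
  have := Nat.le_of_dvd hpf.out.pos h
  nlinarith [hpf.out.two_le]

theorem exists_unit (x : ZMod (p ^ 2)) (h : ¬ IsUnit x) (hx : x ≠ 0) :
    ∃ u : ZMod (p ^ 2), IsUnit u ∧ x = (p : ZMod (p ^ 2)) * u := by
  obtain ⟨k, hk⟩ := (not_isUnit_iff x).1 h
  refine ⟨k, ?_, hk⟩
  by_contra h'
  obtain ⟨l, rfl⟩ := (not_isUnit_iff k).1 h'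
  rw [← mul_assoc, p_mul_p, zero_mul] at hk
  exact hx hk

theorem red_equiv : ∃ e : ZMod (p ^ 2) ≃ ZMod p × ZMod p, ∀ x, (e x).1 =
    ZMod.castHom (dvd_pow_self p two_ne_zero) (ZMod p) x := by
  have : NeZero (p ^ 2) := ⟨pow_ne_zero _ hpf.out.ne_zero⟩
  let f : ZMod (p ^ 2) → ZMod p × ZMod p := fun x =>
    (ZMod.castHom (dvd_pow_self p two_ne_zero) (ZMod p) x, ((x.val / p : ℕ) : ZMod p))
  have hf : Function.Injective f := by
    intro x y h
    simp only [f, Prod.mk.injEq] at h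
    obtain ⟨h1, h2⟩ := h
    have hx := ZMod.natCast_zmod_val x
    have hy := ZMod.natCast_zmod_val y
    rw [← hx, ← hy, map_natCast, map_natCast, ZMod.natCast_eq_natCast_iff] at h1
    rw [ZMod.natCast_eq_natCast_iff] at h2
    have b1 : x.val / p < p := by
      rw [Nat.div_lt_iff_lt_mul hpf.out.pos, ← sq]; exact ZMod.val_lt x
    have b2 : y.val / p < p := by
      rw [Nat.div_lt_iff_lt_mul hpf.out.pos, ← sq]; exact ZMod.val_lt y
    have h3 := Nat.ModEq.eq_of_lt_of_lt h2 b1 b2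
    apply ZMod.val_injective
    rw [← Nat.div_add_mod x.val p, ← Nat.div_add_mod y.val p, h3, h1]
  have hb : Function.Bijective f := by
    rw [Nat.bijective_iff_injective_and_card]
    exact ⟨hf, by simp [sq]⟩
  exact ⟨Equiv.ofBijective f hb, fun _ => rfl⟩

theorem card_red (P : ZMod p → Prop) : Nat.card {x : ZMod (p ^ 2) //
    P (ZMod.castHom (dvd_pow_self p two_ne_zero) (ZMod p) x)} = Nat.card {y // P y} * p := by
  obtain ⟨e, he⟩ := red_equiv (p := p)
  rw [card_pull _ e he, Nat.card_zmod]

theorem card_red2 (P : ZMod p × ZMod p → Prop) : Nat.card {x : ZMod (p ^ 2) × ZMod (p ^ 2) //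
    P (ZMod.castHom (dvd_pow_self p two_ne_zero) (ZMod p) x.1,
      ZMod.castHom (dvd_pow_self p two_ne_zero) (ZMod p) x.2)} =
      Nat.card {y // P y} * (p * p) := by
  obtain ⟨e, he⟩ := red_equiv (p := p)
  let e' : ZMod (p ^ 2) × ZMod (p ^ 2) ≃ (ZMod p × ZMod p) × (ZMod p × ZMod p) :=
    (Equiv.prodCongr e e).trans (Equiv.prodProdProdComm _ _ _ _)
  rw [card_pull (Y := ZMod p × ZMod p) (fun x : ZMod (p ^ 2) × ZMod (p ^ 2) =>
    (ZMod.castHom (dvd_pow_self p two_ne_zero) (ZMod p) x.1,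
      ZMod.castHom (dvd_pow_self p two_ne_zero) (ZMod p) x.2)) e', Nat.card_prod, Nat.card_zmod]
  intro x
  simp [e', he]

abbrev R2 (p : ℕ) := ZMod (p ^ 2)

def mulT (a b c : R2 p) : Tri (R2 p) (R2 p) := ⟨LinearMap.mulLeft _ a, LinearMap.mulLeft _ b, c⟩

theorem mulLeft_bij {a : R2 p} (h : IsUnit a) : Function.Bijective (LinearMap.mulLeft (R2 p) a) := by
  have := h.unit.mulLeft.bijective
  exact this

theorem isUnit_of_bij {a : R2 p} (h : Function.Bijective (LinearMap.mulLeft (R2 p) a)) :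
    IsUnit a := by
  obtain ⟨b, hb⟩ := h.2 1
  exact IsUnit.of_mul_eq_one b hb

theorem mulT_valid {a b c : R2 p} : (mulT a b c).Valid ↔ IsUnit a ∧ IsUnit b := by
  constructor
  · rintro ⟨h1, h2, -⟩
    exact ⟨isUnit_of_bij h1, isUnit_of_bij h2⟩
  · rintro ⟨h1, h2⟩
    refine ⟨mulLeft_bij h1, mulLeft_bij h2, fun x => ?_⟩
    simp [mulT]; ring

theorem eq_mulT (τ : Tri (R2 p) (R2 p)) : τ = mulT (τ.A 1) (τ.B 1) τ.c := by
  obtain ⟨A, B, c⟩ := τ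
  simp only [mulT, Tri.mk.injEq, and_true]
  constructor <;> ext <;> simp

theorem mulT_rel {a b c a' b' c' : R2 p} : (mulT a b c).rel (mulT a' b' c') ↔
    a' = a ∧ b' = b ∧ ∃ u t, IsUnit u ∧ u * c' = c + (1 - a - b) * t := by
  constructor
  · rintro ⟨g, t, h1, h2, h3⟩
    have hg : ∀ x, g x = g 1 * x := fun x => by
      have := g.map_smul x 1
      rw [smul_eq_mul, mul_one, smul_eq_mul] at this
      rw [this, mul_comm]
    have hu : IsUnit (g 1) := by
      obtain ⟨s, hs⟩ := g.surjective 1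
      rw [hg] at hs
      exact IsUnit.of_mul_eq_one s hs
    have h1' := h1 1
    have h2' := h2 1
    simp only [mulT, LinearMap.mulLeft_apply, mul_one] at h1' h2' h3
    rw [hg, mul_comm] at h1' h2'
    refine ⟨hu.mul_right_cancel h1', hu.mul_right_cancel h2', g 1, t, hu, ?_⟩
    rw [← hg, h3]; ring
  · rintro ⟨rfl, rfl, u, t, hu, h⟩
    refine ⟨LinearEquiv.ofBijective _ (mulLeft_bij hu), t, fun x => ?_, fun x => ?_, ?_⟩
    · simp [mulT]; ring
    · simp [mulT]; ring
    · simp only [mulT, LinearEquiv.ofBijective_apply, LinearMap.mulLeft_apply, h]; ring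

theorem mulT_ext {a b c : R2 p} : (mulT a b c).Ext ↔ ∀ s, (1 - a - b) * s ≠ c := by
  refine forall_congr' fun s => ?_
  have : s - a * s - b * s = (1 - a - b) * s := by ring
  simp [mulT, this]

theorem mulT_cZero {a b c : R2 p} : (mulT a b c).CZero ↔ 1 - a - b = 0 := by
  have : ∀ s, s - a * s - b * s = (1 - a - b) * s := fun s => by ring
  constructor
  · intro h
    simpa [mulT, this] using h 1
  · intro h s
    simp [mulT, this, h]

theorem count_psq : HasCount (Tri.rel (R := R2 p) (M := R2 p)) Tri.Valid
    (((p - 2) * p + (p - 2) * (p * p)) + ((p - 1) * (p - 1)) * (p * p)) := by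
  have : NeZero (p ^ 2) := ⟨pow_ne_zero _ hpf.out.ne_zero⟩
  refine HasCount.split' Tri.Ext (fun _ _ => Tri.rel.ext)
    (HasCount.split' (fun τ => τ.CZero ∧ ¬ IsUnit τ.c) ?_ ?_ ?_) ?_
  · intro τ τ' h
    rw [eq_mulT τ, eq_mulT τ'] at *
    generalize τ.A 1 = a at *
    generalize τ.B 1 = b at *
    rintro ⟨h1, h2⟩
    refine ⟨h.cZero h1, ?_⟩
    rw [mulT_cZero] at h1
    rw [mulT_rel] at h
    obtain ⟨rfl, rfl, u, t, hu, h⟩ := h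
    rw [h1, zero_mul, add_zero] at h
    intro h'
    apply h2
    simp only [mulT] at *
    rw [← h]
    exact hu.mul h'
  · refine ⟨{x : R2 p // IsUnit x ∧ IsUnit (1 - x)}, inferInstance, fun a => mulT a.1 (1 - a.1) p,
      ?_, ?_, ?_, ?_⟩
    · rw [← card_ne_one (p := p), ← card_red]
      refine card_iff fun x => ?_
      rw [isUnit_iff_red, isUnit_iff_red, map_sub, map_one]
    · rintro ⟨a, h1, h2⟩
      refine ⟨⟨mulT_valid.2 ⟨h1, h2⟩, mulT_ext.2 ?_⟩, mulT_cZero.2 (by ring), ?_⟩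
      · intro s
        simp only [sub_self, zero_mul]
        exact p_ne.symm
      · simp only [mulT]
        exact (not_isUnit_iff _).2 ⟨1, by simp⟩
    · rintro ⟨a, h1, h2⟩ ⟨a', h1', h2'⟩ h
      exact Subtype.ext (mulT_rel.1 h).1.symm
    · intro τ
      rw [eq_mulT τ]
      generalize τ.A 1 = a
      generalize τ.B 1 = b
      rintro ⟨⟨h1, h2⟩, h3, h4⟩
      rw [mulT_valid] at h1
      rw [mulT_cZero] at h3
      rw [mulT_ext] at h2
      obtain ⟨u, hu, hc⟩ := exists_unit _ h4 (fun h => h2 0 (by rw [mul_zero]; exact h.symm))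
      simp only [mulT] at hc
      have hb : b = 1 - a := by rw [sub_eq_zero] at h3; exact h3.symm
      refine ⟨⟨a, h1.1, hb ▸ h1.2⟩, mulT_rel.2 ⟨rfl, hb.symm, u, 0, hu, ?_⟩⟩
      rw [hc]; ring
  · refine ⟨{x : R2 p × R2 p // IsUnit x.1 ∧ IsUnit x.2 ∧ ¬ IsUnit (1 - x.1 - x.2)},
      inferInstance, fun a => mulT a.1.1 a.1.2 1, ?_, ?_, ?_, ?_⟩
    · rw [← card_sum_one (p := p), ← card_red2]
      refine card_iff fun x => ?_
      rw [isUnit_iff_red, isUnit_iff_red, isUnit_iff_red, map_sub, map_sub, map_one, not_not]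
    · rintro ⟨⟨a, b⟩, h1, h2, h3⟩
      refine ⟨⟨mulT_valid.2 ⟨h1, h2⟩, mulT_ext.2 ?_⟩, ?_⟩
      · intro s hs
        exact h3 (IsUnit.of_mul_eq_one s hs)
      · simp [mulT]
    · rintro ⟨⟨a, b⟩, h1⟩ ⟨⟨a', b'⟩, h1'⟩ h
      obtain ⟨h2, h3, -⟩ := mulT_rel.1 h
      exact Subtype.ext (Prod.ext h2.symm h3.symm)
    · intro τ
      rw [eq_mulT τ]
      generalize τ.A 1 = a
      generalize τ.B 1 = b
      generalize τ.c = c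
      rintro ⟨⟨h1, h2⟩, h3⟩
      rw [mulT_valid] at h1
      rw [mulT_cZero] at h3
      rw [mulT_ext] at h2
      simp only [mulT] at h3
      have hn : ¬ IsUnit (1 - a - b) := by
        intro h
        obtain ⟨s, hs⟩ := (mulLeft_bij h).2 c
        exact h2 s hs
      have hc : IsUnit c := by
        by_contra hc
        by_cases h0 : 1 - a - b = 0
        · exact h3 ⟨h0, hc⟩
        · obtain ⟨u, hu, hu'⟩ := exists_unit _ hn h0
          obtain ⟨k, hk⟩ := (not_isUnit_iff _).1 hc
          obtain ⟨v, hv⟩ := hu.exists_right_inv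
          apply h2 (v * k)
          rw [hu', hk, mul_assoc, ← mul_assoc u, hv, one_mul]
      refine ⟨⟨(a, b), h1.1, h1.2, hn⟩, mulT_rel.2 ⟨rfl, rfl, c, 0, hc, ?_⟩⟩
      ring
  · refine ⟨{x : R2 p × R2 p // IsUnit x.1 ∧ IsUnit x.2},
      inferInstance, fun a => mulT a.1.1 a.1.2 0, ?_, ?_, ?_, ?_⟩
    · rw [← card_ne_prod (p := p), ← card_red2]
      refine card_iff fun x => ?_
      rw [isUnit_iff_red, isUnit_iff_red]
    · rintro ⟨⟨a, b⟩, h1, h2⟩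
      refine ⟨mulT_valid.2 ⟨h1, h2⟩, ?_⟩
      rw [mulT_ext]
      push Not
      exact ⟨0, by simp⟩
    · rintro ⟨⟨a, b⟩, h1⟩ ⟨⟨a', b'⟩, h1'⟩ h
      obtain ⟨h2, h3, -⟩ := mulT_rel.1 h
      exact Subtype.ext (Prod.ext h2.symm h3.symm)
    · intro τ
      rw [eq_mulT τ]
      generalize τ.A 1 = a
      generalize τ.B 1 = b
      generalize τ.c = c
      rintro ⟨h1, h2⟩
      rw [mulT_valid] at h1
      rw [mulT_ext] at h2
      push Not at h2
      obtain ⟨s, hs⟩ := h2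
      refine ⟨⟨(a, b), h1.1, h1.2⟩, mulT_rel.2 ⟨rfl, rfl, 1, -s, isUnit_one, ?_⟩⟩
      rw [← hs]; ring

end psq


section plane
variable {p : ℕ} [hpf : Fact p.Prime]

abbrev V2 (p : ℕ) := ZMod p × ZMod p
abbrev T2 (p : ℕ) := Tri (ZMod p) (V2 p)

def mat (a b c d : ZMod p) : V2 p →ₗ[ZMod p] V2 p where
  toFun x := (a * x.1 + b * x.2, c * x.1 + d * x.2)
  map_add' x y := by ext <;> simp <;> ring
  map_smul' r x := by ext <;> simp <;> ring

theorem mat_apply (a b c d : ZMod p) (x : V2 p) :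
    mat a b c d x = (a * x.1 + b * x.2, c * x.1 + d * x.2) := rfl

theorem mat_bij (a b c d : ZMod p) : Function.Bijective (mat a b c d) ↔ a * d - b * c ≠ 0 := by
  constructor
  · intro h h0
    have h1 : mat a b c d (d, -c) = mat a b c d 0 := by
      rw [map_zero]; ext <;> simp [mat_apply] <;> first | ring1 | linear_combination h0
    have h2 : mat a b c d (-b, a) = mat a b c d 0 := by
      rw [map_zero]; ext <;> simp [mat_apply] <;> first | ring1 | linear_combination h0
    have h1' := h.1 h1
    have h2' := h.1 h2
    simp only [Prod.ext_iff, Prod.fst_zero, Prod.snd_zero, neg_eq_zero] at h1' h2'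
    have : mat a b c d (1, 0) = mat a b c d 0 := by
      rw [map_zero]; ext <;> simp [mat_apply, h1', h2']
    have := h.1 this
    simp at this
  · intro h
    have hi : Function.Injective (mat a b c d) := by
      rw [injective_iff_map_eq_zero]
      intro x hx
      simp only [mat_apply, Prod.ext_iff, Prod.fst_zero, Prod.snd_zero] at hx ⊢
      constructor
      · apply mul_left_cancel₀ h
        linear_combination d * hx.1 - b * hx.2
      · apply mul_left_cancel₀ h
        linear_combination a * hx.2 - c * hx.1
    exact ⟨hi, LinearMap.injective_iff_surjective.1 hi⟩

def dt (v w : V2 p) : ZMod p := v.1 * w.2 - w.1 * v.2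

theorem coords {v w : V2 p} (h : dt v w ≠ 0) (x : V2 p) : ∃ α β : ZMod p, x = α • v + β • w := by
  obtain ⟨y, hy⟩ := ((mat_bij v.1 w.1 v.2 w.2).2 h).2 x
  refine ⟨y.1, y.2, ?_⟩
  rw [← hy, mat_apply]
  ext <;> simp <;> ring

theorem dt_zero {v w : V2 p} (hv : v ≠ 0) (h : dt v w = 0) : ∃ l : ZMod p, w = l • v := by
  unfold dt at h
  by_cases h1 : v.1 = 0
  · have h2 : v.2 ≠ 0 := fun h2 => hv (Prod.ext h1 h2)
    refine ⟨w.2 / v.2, ?_⟩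
    have : w.1 = 0 := by
      rw [h1] at h
      have : w.1 * v.2 = 0 := by linear_combination -h
      exact (mul_eq_zero.1 this).resolve_right h2
    ext
    · simp [h1, this]
    · simp [h2]
  · refine ⟨w.1 / v.1, ?_⟩
    ext
    · simp [h1]
    · simp only [Prod.smul_snd, smul_eq_mul]
      field_simp
      linear_combination h

theorem exists_dt {v : V2 p} (hv : v ≠ 0) : ∃ w, dt v w ≠ 0 := by
  by_cases h1 : v.1 = 0
  · have h2 : v.2 ≠ 0 := fun h2 => hv (Prod.ext h1 h2)
    exact ⟨(1, 0), by simp [dt, h2]⟩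
  · exact ⟨(0, 1), by simp [dt, h1]⟩

def Scal (A : V2 p →ₗ[ZMod p] V2 p) : Prop := ∃ a : ZMod p, ∀ x, A x = a • x

theorem exists_cyclic_s1 {A : V2 p →ₗ[ZMod p] V2 p} (h : ¬ Scal A) : ∃ v, dt v (A v) ≠ 0 := by
  by_contra hn
  push Not at hn
  apply h
  have h1 := hn (1, 0)
  have h2 := hn (0, 1)
  have h3 := hn (1, 1)
  have e : A (1, 1) = A (1, 0) + A (0, 1) := by rw [← map_add]; simp
  simp only [dt, e, Prod.fst_add, Prod.snd_add] at h1 h2 h3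
  refine ⟨(A (1, 0)).1, fun x => ?_⟩
  have : x = x.1 • ((1, 0) : V2 p) + x.2 • ((0, 1) : V2 p) := by ext <;> simp
  have e2 : A x = x.1 • A (1, 0) + x.2 • A (0, 1) := by
    conv_lhs => rw [this]
    rw [map_add, map_smul, map_smul]
  rw [e2]
  ext
  · simp only [Prod.fst_add, Prod.smul_fst, smul_eq_mul]
    linear_combination (-x.2) * h2
  · simp only [Prod.snd_add, Prod.smul_snd, smul_eq_mul]
    linear_combination x.1 * h1 + x.2 * h3 - x.2 * h1 - x.2 * h2

theorem rel_of_basis (τ : T2 p) {v w : V2 p} (h : dt v w ≠ 0)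
    {a b c d a' b' c' d' e f : ZMod p} (s : V2 p)
    (hAv : τ.A v = a • v + c • w) (hAw : τ.A w = b • v + d • w)
    (hBv : τ.B v = a' • v + c' • w) (hBw : τ.B w = b' • v + d' • w)
    (hc : e • v + f • w = τ.c + (s - τ.A s - τ.B s)) :
    τ.rel ⟨mat a b c d, mat a' b' c' d', (e, f)⟩ := by
  have hg : ∀ x, mat v.1 w.1 v.2 w.2 x = x.1 • v + x.2 • w := fun x => by
    rw [mat_apply]; ext <;> simp <;> ring
  refine ⟨LinearEquiv.ofBijective _ ((mat_bij v.1 w.1 v.2 w.2).2 h), s, fun x => ?_, fun x => ?_, ?_⟩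
  · simp only [LinearEquiv.ofBijective_apply, hg, map_add, map_smul, hAv, hAw, mat_apply]
    module
  · simp only [LinearEquiv.ofBijective_apply, hg, map_add, map_smul, hBv, hBw, mat_apply]
    module
  · simp only [LinearEquiv.ofBijective_apply, hg]
    exact hc

theorem Tri.rel.valid {R M : Type} [CommRing R] [AddCommGroup M] [Module R M] {τ τ' : Tri R M}
    (h : τ.rel τ') (hv : τ.Valid) : τ'.Valid := by
  obtain ⟨g, t, h1, h2, -⟩ := h
  obtain ⟨v1, v2, v3⟩ := hv
  refine ⟨?_, ?_, ?_⟩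
  · have : (τ'.A : M → M) = g.symm ∘ τ.A ∘ g := by
      funext x; simp [← h1]
    rw [this]
    exact g.symm.bijective.comp (v1.comp g.bijective)
  · have : (τ'.B : M → M) = g.symm ∘ τ.B ∘ g := by
      funext x; simp [← h2]
    rw [this]
    exact g.symm.bijective.comp (v2.comp g.bijective)
  · intro x
    apply g.injective
    simp only [h1, h2, v3]

theorem rel_scalA {τ τ' : T2 p} (h : τ.rel τ') (hs : Scal τ.A) : Scal τ'.A := by
  obtain ⟨g, t, h1, h2, -⟩ := h
  obtain ⟨a, ha⟩ := hs
  refine ⟨a, fun x => g.injective ?_⟩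
  rw [h1, ha, map_smul]

theorem rel_scalB {τ τ' : T2 p} (h : τ.rel τ') (hs : Scal τ.B) : Scal τ'.B := by
  obtain ⟨g, t, h1, h2, -⟩ := h
  obtain ⟨a, ha⟩ := hs
  refine ⟨a, fun x => g.injective ?_⟩
  rw [h2, ha, map_smul]

def Eig (τ : T2 p) : Prop := τ.CZero ∧ ∃ l : ZMod p, τ.A τ.c = l • τ.c

theorem rel_eig {τ τ' : T2 p} (h : τ.rel τ') (hs : Eig τ) : Eig τ' := by
  refine ⟨h.cZero hs.1, ?_⟩
  obtain ⟨g, t, h1, h2, h3⟩ := h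
  obtain ⟨h0, l, hl⟩ := hs
  refine ⟨l, g.injective ?_⟩
  rw [h0, add_zero] at h3
  rw [h1, map_smul, h3, hl]

theorem mat_valid {a b c d a' b' c' d' : ZMod p} {e : V2 p} (h1 : a * d - b * c ≠ 0)
    (h2 : a' * d' - b' * c' ≠ 0) (h3 : b * c' = b' * c) 
    (h4 : a * b' + b * d' = a' * b + b' * d) (h5 : c * a' + d * c' = c' * a + d' * c) :
    (⟨mat a b c d, mat a' b' c' d', e⟩ : T2 p).Valid := by
  refine ⟨(mat_bij _ _ _ _).2 h1, (mat_bij _ _ _ _).2 h2, fun x => ?_⟩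
  simp only [mat_apply]
  ext
  · simp only
    linear_combination x.1 * h3 + x.2 * h4
  · simp only
    linear_combination x.1 * h5 - x.2 * h3

theorem of_mat_valid {a b c d a' b' c' d' : ZMod p} {e : V2 p}
    (h : (⟨mat a b c d, mat a' b' c' d', e⟩ : T2 p).Valid) :
    a * d - b * c ≠ 0 ∧ a' * d' - b' * c' ≠ 0 :=
  ⟨(mat_bij _ _ _ _).1 h.1, (mat_bij _ _ _ _).1 h.2.1⟩

theorem comp_inj (g : V2 p ≃ₗ[ZMod p] V2 p) {A A' : V2 p →ₗ[ZMod p] V2 p} {t d t' d' : ZMod p}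
    (hA : ∀ x, A x = mat 0 (-d) 1 t x) (hA' : ∀ x, A' x = mat 0 (-d') 1 t' x)
    (h : ∀ x, g (A' x) = A (g x)) :
    t' = t ∧ d' = d := by
  obtain ⟨e, he⟩ := g.surjective (1, 0)
  have e1 : g (A' e) = (0, 1) := by rw [h, he, hA, mat_apply]; simp
  have e2 : g (A' (A' e)) = (-d, t) := by rw [h, e1, hA, mat_apply]; simp
  have e3 : A' (A' e) = t' • A' e - d' • e := by
    simp only [hA', mat_apply]; ext <;> simp <;> ring
  rw [e3, map_sub, map_smul, map_smul, e1, he] at e2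
  simpa [and_comm, Prod.ext_iff] using e2

theorem lin_inj (g : V2 p ≃ₗ[ZMod p] V2 p) {A A' B B' : V2 p →ₗ[ZMod p] V2 p}
    {t d x y x' y' : ZMod p}
    (hA : ∀ x, A x = mat 0 (-d) 1 t x) 
    (h : ∀ x, g (A' x) = A (g x)) (h2 : ∀ x, g (B' x) = B (g x))
    (hB : ∀ z, B z = x • z + y • A z) (hB' : ∀ z, B' z = x' • z + y' • A' z) :
    x' = x ∧ y' = y := by
  obtain ⟨e, he⟩ := g.surjective (1, 0)
  have e1 : g (A' e) = (0, 1) := by rw [h, he, hA, mat_apply]; simp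
  have e2 := h2 e
  rw [hB', map_add, map_smul, map_smul, e1, he, hB, hA, mat_apply] at e2
  simpa [Prod.ext_iff] using e2

theorem scal_inj (g : V2 p ≃ₗ[ZMod p] V2 p) {A A' : V2 p →ₗ[ZMod p] V2 p} {a a' : ZMod p}
    (hA : ∀ x, A x = mat a 0 0 a x) (hA' : ∀ x, A' x = mat a' 0 0 a' x)
    (h : ∀ x, g (A' x) = A (g x)) : a' = a := by
  obtain ⟨e, he⟩ := g.surjective (1, 0)
  have := h e
  have e1 : A' e = a' • e := by rw [hA', mat_apply]; ext <;> simp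
  rw [e1, map_smul, he, hA, mat_apply] at this
  simpa using this

theorem scal_mat (a : ZMod p) : Scal (mat a 0 0 a) := ⟨a, fun x => by rw [mat_apply]; ext <;> simp⟩

theorem not_scal_mat {a b c d : ZMod p} (h : b ≠ 0 ∨ c ≠ 0) : ¬ Scal (mat a b c d) := by
  rintro ⟨l, hl⟩
  have h1 := hl (1, 0)
  have h2 := hl (0, 1)
  simp [mat_apply] at h1 h2
  tauto

end plane


section planecount
variable {p : ℕ} [hpf : Fact p.Prime]

theorem card_lin {m n : ZMod p} (hm : m ≠ 0) : Nat.card {t : ZMod p // m * t + n ≠ 0} = p - 1 := by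
  rw [← card_ne (-n / m)]
  refine card_iff fun t => not_congr ?_
  rw [eq_div_iff hm, add_eq_zero_iff_eq_neg, mul_comm]

theorem cardE2 : Nat.card {q : ZMod p × ZMod p // q.1 ≠ 0 ∧ 1 - q.2 + q.1 ≠ 0} =
    (p - 1) * (p - 1) := by
  rw [card_fib (fun d t : ZMod p => d ≠ 0 ∧ 1 - t + d ≠ 0) (fun d => d ≠ 0) (p - 1)
    (fun x y h => h.1), card_ne]
  intro d hd
  rw [← card_lin (m := -1) (n := 1 + d) (by simp)]
  refine card_iff fun t => ?_
  rw [show 1 - t + d = -1 * t + (1 + d) by ring]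
  simp [hd]

theorem cardE3 : Nat.card {q : ZMod p × ZMod p //
    (q.1 ≠ 0 ∧ 1 - q.1 ≠ 0) ∧ (q.2 ≠ 0 ∧ 1 - q.2 ≠ 0)} = (p - 2) * (p - 2) := by
  rw [card_fib (fun a b : ZMod p => (a ≠ 0 ∧ 1 - a ≠ 0) ∧ (b ≠ 0 ∧ 1 - b ≠ 0))
    (fun a => a ≠ 0 ∧ 1 - a ≠ 0) (p - 2) (fun x y h => h.1), card_ne_one]
  intro d hd
  rw [← card_ne_one (p := p)]
  exact card_iff fun t => by simp only [hd, and_self, true_and, ne_eq, not_false_eq_true]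

theorem cardE4 : Nat.card {q : ZMod p × ZMod p × ZMod p //
    (q.1 ≠ 0 ∧ 1 - q.1 ≠ 0) ∧ q.1 + q.2.2 * q.2.1 ≠ 0 ∧ 1 - q.1 - (1 + q.2.2) * q.2.1 ≠ 0} =
    (p - 2) * (p + ((p - 1) + (p - 2) * (p - 2))) := by
  rw [card_fib (fun (x : ZMod p) (r : ZMod p × ZMod p) =>
    (x ≠ 0 ∧ 1 - x ≠ 0) ∧ x + r.2 * r.1 ≠ 0 ∧ 1 - x - (1 + r.2) * r.1 ≠ 0)
    (fun a => a ≠ 0 ∧ 1 - a ≠ 0) _ (fun x y h => h.1), card_ne_one]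
  rintro x ⟨hx, hx1⟩
  rw [card_split _ (fun r : ZMod p × ZMod p => r.1 = 0)]
  congr 1
  · rw [card_fib (fun t y : ZMod p => ((x ≠ 0 ∧ 1 - x ≠ 0) ∧ x + y * t ≠ 0 ∧
      1 - x - (1 + y) * t ≠ 0) ∧ t = 0) (fun t => t = 0) p (fun x y h => h.2), card_one, one_mul]
    rintro t rfl
    refine Eq.trans ?_ (card_all (p := p))
    exact card_iff fun y => by simp [hx]; simpa using hx1
  rw [card_split _ (fun r : ZMod p × ZMod p => r.1 = 1)]
  congr 1
  · rw [card_fib (fun t y : ZMod p => (((x ≠ 0 ∧ 1 - x ≠ 0) ∧ x + y * t ≠ 0 ∧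
      1 - x - (1 + y) * t ≠ 0) ∧ ¬ t = 0) ∧ t = 1) (fun t => t = 1) (p - 1) (fun x y h => h.2),
      card_one, one_mul]
    rintro t rfl
    rw [← card_ne (-x)]
    refine card_iff fun y => ?_
    have e1 : x + y * 1 = 0 ↔ y = -x := by rw [mul_one, add_comm, add_eq_zero_iff_eq_neg]
    have e2 : 1 - x - (1 + y) * 1 = 0 ↔ y = -x := by
      constructor
      · intro h; linear_combination -h
      · intro h; linear_combination -h
    simp only [ne_eq, e1, e2]
    simp [hx, hx1]
  · rw [card_fib (fun t y : ZMod p => (((x ≠ 0 ∧ 1 - x ≠ 0) ∧ x + y * t ≠ 0 ∧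
      1 - x - (1 + y) * t ≠ 0) ∧ ¬ t = 0) ∧ ¬ t = 1) (fun t => t ≠ 0 ∧ t ≠ 1) (p - 2)
      (fun x y h => ⟨h.1.2, h.2⟩), card_ne_ne _ _ zero_ne_one]
    rintro t ⟨ht, ht1⟩
    rw [← card_ne_ne (-x / t) ((1 - x - t) / t)]
    · refine card_iff fun y => ?_
      have e1 : x + y * t = 0 ↔ y = -x / t := by
        rw [eq_div_iff ht, add_comm, add_eq_zero_iff_eq_neg]
      have e2 : 1 - x - (1 + y) * t = 0 ↔ y = (1 - x - t) / t := by
        rw [eq_div_iff ht]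
        constructor
        · intro h; linear_combination -h
        · intro h; linear_combination -h
      simp only [ne_eq, e1, e2]
      simp [hx, hx1, ht, ht1]
    · intro h
      rw [div_left_inj' ht] at h
      apply ht1
      linear_combination h

theorem cardN2 : Nat.card {q : ZMod p × ZMod p × ZMod p // q.1 ≠ 0 ∧ q.2.1 ≠ 0} =
    (p - 1) * ((p - 1) * p) := by
  rw [card_fib (fun (a : ZMod p) (r : ZMod p × ZMod p) => a ≠ 0 ∧ r.1 ≠ 0)
    (fun a => a ≠ 0) _ (fun x y h => h.1), card_ne]
  intro a ha
  rw [card_fib (fun d _t : ZMod p => a ≠ 0 ∧ d ≠ 0) (fun a => a ≠ 0) p (fun x y h => h.2), card_ne]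
  intro d hd
  refine Eq.trans ?_ (card_all (p := p))
  exact card_iff fun y => by simp [ha, hd]

theorem cardN3 : Nat.card {q : ZMod p × (ZMod p × ZMod p) × ZMod p //
    q.1 ≠ 0 ∧ (q.2.1.1 * q.2.1.2) * q.2.2 + (q.2.1.1 ^ 2 + q.2.1.2 ^ 2 * q.1) ≠ 0} =
    (p - 1) * ((p - 1) * p + ((p - 1) * p + ((p - 1) * (p - 1)) * (p - 1))) := by
  rw [card_fib (fun (d : ZMod p) (r : (ZMod p × ZMod p) × ZMod p) => d ≠ 0 ∧
    (r.1.1 * r.1.2) * r.2 + (r.1.1 ^ 2 + r.1.2 ^ 2 * d) ≠ 0)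
    (fun a => a ≠ 0) _ (fun x y h => h.1), card_ne]
  intro d hd
  rw [card_split _ (fun r : (ZMod p × ZMod p) × ZMod p => r.1.1 = 0)]
  congr 1
  · rw [card_fib (fun (r : ZMod p × ZMod p) (t : ZMod p) => (d ≠ 0 ∧
      (r.1 * r.2) * t + (r.1 ^ 2 + r.2 ^ 2 * d) ≠ 0) ∧ r.1 = 0) (fun r => r.1 = 0 ∧ r.2 ≠ 0) p]
    · congr 1
      rw [card_fib (fun x y : ZMod p => x = 0 ∧ y ≠ 0) (fun x => x = 0) (p - 1) (fun x y h => h.1),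
        card_one, one_mul]
      rintro x rfl
      rw [← card_ne (0 : ZMod p)]
      exact card_iff fun y => by simp
    · rintro ⟨x, y⟩ t ⟨⟨-, h⟩, h0⟩
      refine ⟨h0, fun h1 => h ?_⟩
      simp only at h0 h1
      simp [h0, h1]
    · rintro ⟨x, y⟩ ⟨h0, h1⟩
      simp only at h0 h1
      refine Eq.trans ?_ (card_all (p := p))
      exact card_iff fun t => by simp [h0, h1, hd]
  rw [card_split _ (fun r : (ZMod p × ZMod p) × ZMod p => r.1.2 = 0)]
  congr 1
  · rw [card_fib (fun (r : ZMod p × ZMod p) (t : ZMod p) => ((d ≠ 0 ∧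
      (r.1 * r.2) * t + (r.1 ^ 2 + r.2 ^ 2 * d) ≠ 0) ∧ ¬ r.1 = 0) ∧ r.2 = 0)
      (fun r => r.1 ≠ 0 ∧ r.2 = 0) p]
    · congr 1
      rw [card_fib (fun x y : ZMod p => x ≠ 0 ∧ y = 0) (fun x => x ≠ 0) 1 (fun x y h => h.1),
        card_ne, mul_one]
      rintro x hx
      rw [← card_one (0 : ZMod p)]
      exact card_iff fun y => by simp [hx]
    · rintro ⟨x, y⟩ t ⟨⟨-, h⟩, h0⟩
      exact ⟨h, h0⟩
    · rintro ⟨x, y⟩ ⟨h0, h1⟩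
      simp only at h0 h1
      refine Eq.trans ?_ (card_all (p := p))
      exact card_iff fun t => by simp [h0, h1, hd]
  · rw [card_fib (fun (r : ZMod p × ZMod p) (t : ZMod p) => ((d ≠ 0 ∧
      (r.1 * r.2) * t + (r.1 ^ 2 + r.2 ^ 2 * d) ≠ 0) ∧ ¬ r.1 = 0) ∧ ¬ r.2 = 0)
      (fun r => r.1 ≠ 0 ∧ r.2 ≠ 0) (p - 1), card_ne_prod]
    · rintro ⟨x, y⟩ t ⟨⟨-, h⟩, h0⟩
      exact ⟨h, h0⟩
    · rintro ⟨x, y⟩ ⟨h0, h1⟩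
      simp only at h0 h1
      rw [← card_lin (m := x * y) (n := x ^ 2 + y ^ 2 * d) (mul_ne_zero h0 h1)]
      exact card_iff fun t => by simp [h0, h1, hd]

end planecount

section planeleaves
variable {p : ℕ} [hpf : Fact p.Prime]

theorem cZero_B {τ : T2 p} (h : τ.CZero) (x : V2 p) : τ.B x = x - τ.A x :=
  (sub_eq_zero.1 (h x)).symm

theorem ext_c_ne {τ : T2 p} (h : τ.Ext) : τ.c ≠ 0 := fun h0 => h 0 (by simp [h0])

theorem leafN1 : HasCount (Tri.rel (R := ZMod p) (M := V2 p))
    (fun τ => ((τ.Valid ∧ ¬ τ.Ext) ∧ Scal τ.A) ∧ Scal τ.B) ((p - 1) * (p - 1)) := by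
  refine ⟨{q : ZMod p × ZMod p // q.1 ≠ 0 ∧ q.2 ≠ 0}, inferInstance,
    fun q => ⟨mat q.1.1 0 0 q.1.1, mat q.1.2 0 0 q.1.2, (0, 0)⟩, card_ne_prod, ?_, ?_, ?_⟩
  · rintro ⟨⟨a, b⟩, ha, hb⟩
    refine ⟨⟨⟨mat_valid (by simpa using ha) (by simpa using hb) (by ring) (by ring) (by ring),
      fun h => ext_c_ne h rfl⟩, scal_mat _⟩, scal_mat _⟩
  · rintro ⟨⟨a, b⟩, ha, hb⟩ ⟨⟨a', b'⟩, ha', hb'⟩ ⟨g, t, h1, h2, -⟩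
    have e1 := scal_inj g (fun _ => rfl) (fun _ => rfl) h1
    have e2 := scal_inj g (fun _ => rfl) (fun _ => rfl) h2
    exact Subtype.ext (Prod.ext e1.symm e2.symm)
  · rintro τ ⟨⟨⟨hv, hE⟩, a, ha⟩, b, hb⟩
    simp only [Tri.Ext, not_forall, not_not] at hE
    obtain ⟨s, hs⟩ := hE
    have hr : τ.rel ⟨mat a 0 0 a, mat b 0 0 b, (0, 0)⟩ := by
      refine rel_of_basis τ (v := (1, 0)) (w := (0, 1)) (by simp [dt]) (-s) ?_ ?_ ?_ ?_ ?_
      · rw [ha]; module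
      · rw [ha]; module
      · rw [hb]; module
      · rw [hb]; module
      · rw [← hs, map_neg, map_neg]; module
    have := of_mat_valid (hr.valid hv)
    simp only [mul_zero, sub_zero, mul_self_ne_zero] at this
    exact ⟨⟨(a, b), this⟩, hr⟩

theorem leafN2 : HasCount (Tri.rel (R := ZMod p) (M := V2 p))
    (fun τ => ((τ.Valid ∧ ¬ τ.Ext) ∧ Scal τ.A) ∧ ¬ Scal τ.B) ((p - 1) * ((p - 1) * p)) := by
  refine ⟨{q : ZMod p × ZMod p × ZMod p // q.1 ≠ 0 ∧ q.2.1 ≠ 0}, inferInstance,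
    fun q => ⟨mat q.1.1 0 0 q.1.1, mat 0 (-q.1.2.1) 1 q.1.2.2, (0, 0)⟩, cardN2, ?_, ?_, ?_⟩
  · rintro ⟨⟨a, d, t⟩, ha, hb⟩
    refine ⟨⟨⟨mat_valid (by simpa using ha) (by simpa using hb) (by ring) (by ring) (by ring),
      fun h => ext_c_ne h rfl⟩, scal_mat _⟩, not_scal_mat (Or.inr one_ne_zero)⟩
  · rintro ⟨⟨a, d, t⟩, ha, hb⟩ ⟨⟨a', d', t'⟩, ha', hb'⟩ ⟨g, s, h1, h2, -⟩
    have e1 := scal_inj g (fun _ => rfl) (fun _ => rfl) h1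
    have e2 := comp_inj g (fun _ => rfl) (fun _ => rfl) h2
    exact Subtype.ext (Prod.ext e1.symm (Prod.ext e2.2.symm e2.1.symm))
  · rintro τ ⟨⟨⟨hv, hE⟩, a, ha⟩, hb⟩
    simp only [Tri.Ext, not_forall, not_not] at hE
    obtain ⟨s, hs⟩ := hE
    obtain ⟨v, hd⟩ := exists_cyclic_s1 hb
    obtain ⟨α, t, hw⟩ := coords hd (τ.B (τ.B v))
    have hr : τ.rel ⟨mat a 0 0 a, mat 0 (-(-α)) 1 t, (0, 0)⟩ := by
      refine rel_of_basis τ hd (-s) ?_ ?_ ?_ ?_ ?_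
      · rw [ha]; module
      · rw [ha]; module
      · module
      · rw [hw]; module
      · rw [← hs, map_neg, map_neg]; module
    have := of_mat_valid (hr.valid hv)
    simp only [mul_zero, sub_zero, mul_self_ne_zero, zero_mul, zero_sub, neg_neg, mul_one] at this
    exact ⟨⟨(a, -α, t), this⟩, hr⟩

theorem leafN3 : HasCount (Tri.rel (R := ZMod p) (M := V2 p))
    (fun τ => (τ.Valid ∧ ¬ τ.Ext) ∧ ¬ Scal τ.A)
    ((p - 1) * ((p - 1) * p + ((p - 1) * p + ((p - 1) * (p - 1)) * (p - 1)))) := by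
  refine ⟨{q : ZMod p × (ZMod p × ZMod p) × ZMod p //
    q.1 ≠ 0 ∧ (q.2.1.1 * q.2.1.2) * q.2.2 + (q.2.1.1 ^ 2 + q.2.1.2 ^ 2 * q.1) ≠ 0}, inferInstance,
    fun q => ⟨mat 0 (-q.1.1) 1 q.1.2.2, mat q.1.2.1.1 (-(q.1.2.1.2 * q.1.1)) q.1.2.1.2
      (q.1.2.1.1 + q.1.2.1.2 * q.1.2.2), (0, 0)⟩, cardN3, ?_, ?_, ?_⟩
  · rintro ⟨⟨d, ⟨x, y⟩, t⟩, ha, hb⟩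
    simp only at ha hb
    refine ⟨⟨mat_valid (by simpa using ha) (fun h => hb (by linear_combination h))
      (by ring) (by ring) (by ring),
      fun h => ext_c_ne h rfl⟩, not_scal_mat (Or.inr one_ne_zero)⟩
  · rintro ⟨⟨d, ⟨x, y⟩, t⟩, ha, hb⟩ ⟨⟨d', ⟨x', y'⟩, t'⟩, ha', hb'⟩ ⟨g, s, h1, h2, -⟩
    have e1 := comp_inj g (fun _ => rfl) (fun _ => rfl) h1
    have e2 := lin_inj (x := x) (y := y) (x' := x') (y' := y') g (fun _ => rfl) h1 h2
      (fun z => by simp only [mat_apply]; ext <;> simp <;> ring)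
      (fun z => by simp only [mat_apply]; ext <;> simp <;> ring)
    exact Subtype.ext (Prod.ext e1.2.symm (Prod.ext (Prod.ext e2.1.symm e2.2.symm) e1.1.symm))
  · rintro τ ⟨⟨hv, hE⟩, ha⟩
    simp only [Tri.Ext, not_forall, not_not] at hE
    obtain ⟨s, hs⟩ := hE
    obtain ⟨v, hd⟩ := exists_cyclic_s1 ha
    obtain ⟨α, t, hw⟩ := coords hd (τ.A (τ.A v))
    obtain ⟨x, y, hB⟩ := coords hd (τ.B v)
    have hr : τ.rel ⟨mat 0 (-(-α)) 1 t, mat x (-(y * -α)) y (x + y * t), (0, 0)⟩ := by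
      refine rel_of_basis τ hd (-s) ?_ ?_ ?_ ?_ ?_
      · module
      · rw [hw]; module
      · rw [hB]
      · rw [← hv.2.2, hB, map_add, map_smul, map_smul, hw]; module
      · rw [← hs, map_neg, map_neg]; module
    have := of_mat_valid (hr.valid hv)
    refine ⟨⟨(-α, (x, y), t), fun h => this.1 ?_, fun h => this.2 ?_⟩, hr⟩
    · simp only at h; linear_combination h
    · simp only at h; linear_combination h

theorem leafE1 : HasCount (Tri.rel (R := ZMod p) (M := V2 p))
    (fun τ => ((τ.Valid ∧ τ.Ext) ∧ τ.CZero) ∧ Scal τ.A) (p - 2) := by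
  refine ⟨{a : ZMod p // a ≠ 0 ∧ 1 - a ≠ 0}, inferInstance,
    fun q => ⟨mat q.1 0 0 q.1, mat (1 - q.1) 0 0 (1 - q.1), (1, 0)⟩, card_ne_one, ?_, ?_, ?_⟩
  · rintro ⟨a, ha, hb⟩
    have hC : (⟨mat a 0 0 a, mat (1 - a) 0 0 (1 - a), (1, 0)⟩ : T2 p).CZero := fun s => by
      simp only [mat_apply]; ext <;> simp <;> ring
    refine ⟨⟨⟨mat_valid (by simpa using ha) (by simpa using hb) (by ring) (by ring) (by ring),
      fun s => ?_⟩, hC⟩, scal_mat _⟩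
    rw [hC s]
    simp [Prod.ext_iff]
  · rintro ⟨a, ha, hb⟩ ⟨a', ha', hb'⟩ ⟨g, t, h1, h2, -⟩
    exact Subtype.ext (scal_inj g (fun _ => rfl) (fun _ => rfl) h1).symm
  · rintro τ ⟨⟨⟨hv, hE⟩, hC⟩, a, ha⟩
    obtain ⟨w, hw⟩ := exists_dt (ext_c_ne hE)
    have hr : τ.rel ⟨mat a 0 0 a, mat (1 - a) 0 0 (1 - a), (1, 0)⟩ := by
      refine rel_of_basis τ hw 0 ?_ ?_ ?_ ?_ ?_
      · rw [ha]; module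
      · rw [ha]; module
      · rw [cZero_B hC, ha]; module
      · rw [cZero_B hC, ha]; module
      · rw [map_zero, map_zero]; module
    have := of_mat_valid (hr.valid hv)
    simp only [mul_zero, sub_zero, mul_self_ne_zero] at this
    exact ⟨⟨a, this⟩, hr⟩

theorem leafE3 : HasCount (Tri.rel (R := ZMod p) (M := V2 p))
    (fun τ => (((τ.Valid ∧ τ.Ext) ∧ τ.CZero) ∧ ¬ Scal τ.A) ∧ Eig τ) ((p - 2) * (p - 2)) := by
  refine ⟨{q : ZMod p × ZMod p // (q.1 ≠ 0 ∧ 1 - q.1 ≠ 0) ∧ (q.2 ≠ 0 ∧ 1 - q.2 ≠ 0)}, inferInstance,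
    fun q => ⟨mat q.1.1 1 0 q.1.2, mat (1 - q.1.1) (-1) 0 (1 - q.1.2), (1, 0)⟩, cardE3, ?_, ?_, ?_⟩
  · rintro ⟨⟨a, b⟩, ⟨ha, ha1⟩, hb, hb1⟩
    simp only at ha ha1 hb hb1
    have hC : (⟨mat a 1 0 b, mat (1 - a) (-1) 0 (1 - b), (1, 0)⟩ : T2 p).CZero := fun s => by
      simp only [mat_apply]; ext <;> simp <;> ring
    refine ⟨⟨⟨⟨mat_valid (by simp [ha, hb]) (by simp [ha1, hb1])
      (by ring) (by ring) (by ring), fun s => ?_⟩, hC⟩, not_scal_mat (Or.inl one_ne_zero)⟩, hC, a, ?_⟩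
    · rw [hC s]
      simp [Prod.ext_iff]
    · simp [mat_apply]
  · rintro ⟨⟨a, b⟩, ⟨ha, ha1⟩, hb, hb1⟩ ⟨⟨a', b'⟩, ⟨ha', ha1'⟩, hb', hb1'⟩ ⟨g, t, h1, h2, h3⟩
    have hC : (⟨mat a 1 0 b, mat (1 - a) (-1) 0 (1 - b), (1, 0)⟩ : T2 p).CZero := fun s => by
      simp only [mat_apply]; ext <;> simp <;> ring
    have h3' : g (1, 0) = (1, 0) := by
      have h4 := hC t
      simp only at h3 h4
      rw [h4, add_zero] at h3
      exact h3
    have e1 := h1 (1, 0)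
    have e2 := h1 (0, 1)
    simp only [h3', mat_apply] at e1 e2
    have f1 : ((a' * 1 + 1 * 0, 0 * 1 + b' * 0) : V2 p) = a' • (1, 0) := by ext <;> simp
    have f2 : ((a' * 0 + 1 * 1, 0 * 0 + b' * 1) : V2 p) = (1, 0) + b' • (0, 1) := by ext <;> simp
    rw [f1, map_smul, h3'] at e1
    rw [f2, map_add, map_smul, h3'] at e2
    have hn : (g (0, 1)).2 ≠ 0 := by
      intro h0
      have : g (0, 1) = g ((g (0, 1)).1 • (1, 0)) := by
        rw [map_smul, h3']; ext <;> simp [h0]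
      have := g.injective this
      simp [Prod.ext_iff] at this
    simp [Prod.ext_iff] at e1 e2
    refine Subtype.ext (Prod.ext e1.symm ?_)
    have := e2.2
    rcases this with h | h
    · exact h.symm
    · exact absurd h hn
  · rintro τ ⟨⟨⟨⟨hv, hE⟩, hC⟩, hS⟩, -, a, ha⟩
    obtain ⟨w0, hw0⟩ := exists_dt (ext_c_ne hE)
    obtain ⟨s, b, hw1⟩ := coords hw0 (τ.A w0)
    obtain ⟨w, hw, hAw⟩ : ∃ w, dt τ.c w ≠ 0 ∧ τ.A w = (1 : ZMod p) • τ.c + b • w := by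
      by_cases hs : s = 0
      · have hab : a - b ≠ 0 := by
          intro h
          apply hS
          refine ⟨a, fun x => ?_⟩
          obtain ⟨α, β, rfl⟩ := coords hw0 x
          rw [map_add, map_smul, map_smul, ha, hw1, hs, ← sub_eq_zero.1 h]
          module
        refine ⟨w0 + (a - b)⁻¹ • τ.c, ?_, ?_⟩
        · intro h; apply hw0
          simp only [dt, Prod.fst_add, Prod.snd_add, Prod.smul_fst, Prod.smul_snd, smul_eq_mul] at h ⊢
          linear_combination h
        · rw [map_add, map_smul, ha, hw1, hs]
          have h1 : (1 : ZMod p) = (a - b) * (a - b)⁻¹ := (mul_inv_cancel₀ hab).symm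
          rw [h1]; module
      · refine ⟨s⁻¹ • w0, ?_, ?_⟩
        · have : dt τ.c (s⁻¹ • w0) = s⁻¹ * dt τ.c w0 := by
            simp only [dt, Prod.smul_fst, Prod.smul_snd, smul_eq_mul]; ring
          rw [this]
          exact mul_ne_zero (inv_ne_zero hs) hw0
        · rw [map_smul, hw1]
          have h1 : (1 : ZMod p) = s * s⁻¹ := (mul_inv_cancel₀ hs).symm
          rw [h1]; module
    have hr : τ.rel ⟨mat a 1 0 b, mat (1 - a) (-1) 0 (1 - b), (1, 0)⟩ := by
      refine rel_of_basis τ hw 0 ?_ ?_ ?_ ?_ ?_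
      · rw [ha]; module
      · rw [hAw]
      · rw [cZero_B hC, ha]; module
      · rw [cZero_B hC, hAw]; module
      · rw [map_zero, map_zero]; module
    have := of_mat_valid (hr.valid hv)
    simp only [mul_zero, sub_zero, mul_ne_zero_iff] at this
    exact ⟨⟨(a, b), ⟨this.1.1, this.2.1⟩, this.1.2, this.2.2⟩, hr⟩

theorem leafE2 : HasCount (Tri.rel (R := ZMod p) (M := V2 p))
    (fun τ => (((τ.Valid ∧ τ.Ext) ∧ τ.CZero) ∧ ¬ Scal τ.A) ∧ ¬ Eig τ) ((p - 1) * (p - 1)) := by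
  refine ⟨{q : ZMod p × ZMod p // q.1 ≠ 0 ∧ 1 - q.2 + q.1 ≠ 0}, inferInstance,
    fun q => ⟨mat 0 (-q.1.1) 1 q.1.2, mat 1 q.1.1 (-1) (1 - q.1.2), (1, 0)⟩, cardE2, ?_, ?_, ?_⟩
  · rintro ⟨⟨d, t⟩, ha, hb⟩
    simp only at ha hb
    have hC : (⟨mat 0 (-d) 1 t, mat 1 d (-1) (1 - t), (1, 0)⟩ : T2 p).CZero := fun s => by
      simp only [mat_apply]; ext <;> simp <;> ring
    refine ⟨⟨⟨⟨mat_valid (by simpa using ha) (fun h => hb (by linear_combination h))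
      (by ring) (by ring) (by ring), fun s => ?_⟩, hC⟩, not_scal_mat (Or.inr one_ne_zero)⟩, ?_⟩
    · rw [hC s]
      simp [Prod.ext_iff]
    · rintro ⟨-, l, hl⟩
      simp [mat_apply] at hl
  · rintro ⟨⟨d, t⟩, ha, hb⟩ ⟨⟨d', t'⟩, ha', hb'⟩ ⟨g, s, h1, h2, -⟩
    have e := comp_inj g (fun _ => rfl) (fun _ => rfl) h1
    exact Subtype.ext (Prod.ext e.2.symm e.1.symm)
  · rintro τ ⟨⟨⟨⟨hv, hE⟩, hC⟩, hS⟩, hEig⟩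
    have hd : dt τ.c (τ.A τ.c) ≠ 0 := fun h => hEig ⟨hC, dt_zero (ext_c_ne hE) h⟩
    obtain ⟨α, t, hw⟩ := coords hd (τ.A (τ.A τ.c))
    have hr : τ.rel ⟨mat 0 (-(-α)) 1 t, mat 1 (-α) (-1) (1 - t), (1, 0)⟩ := by
      refine rel_of_basis τ hd 0 ?_ ?_ ?_ ?_ ?_
      · module
      · rw [hw]; module
      · rw [cZero_B hC]; module
      · rw [cZero_B hC, hw]; module
      · rw [map_zero, map_zero]; module
    have := of_mat_valid (hr.valid hv)
    refine ⟨⟨(-α, t), fun h => this.1 ?_, fun h => this.2 ?_⟩, hr⟩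
    · simp only at h; linear_combination h
    · simp only at h; linear_combination h

theorem leafE4 : HasCount (Tri.rel (R := ZMod p) (M := V2 p))
    (fun τ => (τ.Valid ∧ τ.Ext) ∧ ¬ τ.CZero)
    ((p - 2) * (p + ((p - 1) + (p - 2) * (p - 2)))) := by
  refine ⟨{q : ZMod p × ZMod p × ZMod p //
    (q.1 ≠ 0 ∧ 1 - q.1 ≠ 0) ∧ q.1 + q.2.2 * q.2.1 ≠ 0 ∧ 1 - q.1 - (1 + q.2.2) * q.2.1 ≠ 0},
    inferInstance, fun q => ⟨mat q.1.1 0 q.1.2.2 (q.1.1 + q.1.2.2 * q.1.2.1),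
      mat (1 - q.1.1) 0 (-(1 + q.1.2.2)) (1 - q.1.1 - (1 + q.1.2.2) * q.1.2.1), (1, 0)⟩,
      cardE4, ?_, ?_, ?_⟩
  · rintro ⟨⟨x, t, y⟩, ⟨hx, hx1⟩, hy, hy1⟩
    simp only at hx hx1 hy hy1
    refine ⟨⟨mat_valid (by simpa using ⟨hx, hy⟩) ?_
      (by ring) (by ring) (by ring), fun s h => ?_⟩, fun h => ?_⟩
    · rw [zero_mul, sub_zero]; exact mul_ne_zero hx1 hy1
    · have := congrArg Prod.fst h
      simp only [mat_apply, Prod.fst_sub] at this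
      apply one_ne_zero (α := ZMod p)
      linear_combination -this
    · have := congrArg Prod.snd (h (1, 0))
      simp only [mat_apply, Prod.snd_sub, Prod.snd_zero] at this
      apply one_ne_zero (α := ZMod p)
      linear_combination this
  · rintro ⟨⟨x, t, y⟩, ⟨hx, hx1⟩, hy, hy1⟩ ⟨⟨x', t', y'⟩, ⟨hx', hx1'⟩, hy', hy1'⟩ ⟨g, s, h1, h2, -⟩
    simp only at h1 h2
    have h3 : ∀ z, g (mat 0 (-0) 1 t' z) = mat 0 (-0) 1 t (g z) := by
      intro z
      have a1 : ∀ (x t y : ZMod p) (z : V2 p), mat 0 (-0) 1 t z = z - mat x 0 y (x + y * t) z -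
          mat (1 - x) 0 (-(1 + y)) (1 - x - (1 + y) * t) z := by
        intro x t y z
        simp only [mat_apply]; ext <;> simp <;> ring
      rw [a1 x t y, a1 x' t' y', map_sub, map_sub, h1, h2]
    have e1 := comp_inj g (fun _ => rfl) (fun _ => rfl) h3
    have e2 := lin_inj (x := x) (y := y) (x' := x') (y' := y') g (fun _ => rfl) h3 h1
      (fun z => by simp only [mat_apply]; ext <;> simp <;> ring)
      (fun z => by simp only [mat_apply]; ext <;> simp <;> ring)
    exact Subtype.ext (Prod.ext e2.1.symm (Prod.ext e1.1.symm e2.2.symm))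
  · rintro τ ⟨⟨hv, hE⟩, hC⟩
    obtain ⟨C, hCd⟩ : ∃ C : V2 p →ₗ[ZMod p] V2 p, ∀ x, C x = x - τ.A x - τ.B x :=
      ⟨LinearMap.id - τ.A - τ.B, fun x => rfl⟩
    have hE' : ∀ s, C s ≠ τ.c := fun s => by rw [hCd]; exact hE s
    obtain ⟨s0, hs0⟩ : ∃ s, C s ≠ 0 := by
      by_contra h
      push Not at h
      exact hC fun s => by rw [← hCd]; exact h s
    have hB : ∀ x, τ.B x = x - τ.A x - C x := fun x => by rw [hCd]; abel
    have hAC : ∀ x, τ.A (C x) = C (τ.A x) := fun x => by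
      rw [hCd, hCd, map_sub, map_sub, hv.2.2]
    obtain ⟨s, hs⟩ : ∃ s, C (τ.c + C s) ≠ 0 := by
      by_contra h
      push Not at h
      have h0 : C τ.c = 0 := by simpa using h 0
      have h1 : ∀ s, C (C s) = 0 := fun s => by simpa [h0] using h s
      by_cases hd : dt (C s0) τ.c = 0
      · obtain ⟨l, hl⟩ := dt_zero hs0 hd
        exact hE' (l • s0) (by rw [map_smul, hl])
      · obtain ⟨α, β, hab⟩ := coords hd s0
        apply hs0
        rw [hab, map_add, map_smul, map_smul, h1, h0]
        simp
    have hd : dt (τ.c + C s) (C (τ.c + C s)) ≠ 0 := by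
      intro h
      have h' : dt (C (τ.c + C s)) (τ.c + C s) = 0 := by
        unfold dt at h ⊢
        linear_combination -h
      obtain ⟨l, hl⟩ := dt_zero hs h'
      apply hE' (l • (τ.c + C s) - s)
      rw [map_sub, map_smul, ← hl]; abel
    obtain ⟨v, hvd⟩ : ∃ v, v = τ.c + C s := ⟨_, rfl⟩
    rw [← hvd] at hd
    obtain ⟨α, t, hw⟩ := coords hd (C (C v))
    have hα : α = 0 := by
      by_contra hα
      apply hE' (α⁻¹ • (C v - t • v) - s)
      have : v = α⁻¹ • (C (C v) - t • C v) := by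
        rw [hw, add_sub_cancel_right, smul_smul, inv_mul_cancel₀ hα, one_smul]
      rw [map_sub, map_smul, map_sub, map_smul, ← this, hvd]; abel
    rw [hα, zero_smul, zero_add] at hw
    obtain ⟨x, y, hA⟩ := coords hd (τ.A v)
    have hAw : τ.A (C v) = (x + y * t) • C v := by
      rw [hAC, hA, map_add, map_smul, map_smul, hw]; module
    have hr : τ.rel ⟨mat x 0 y (x + y * t), mat (1 - x) 0 (-(1 + y)) (1 - x - (1 + y) * t),
        (1, 0)⟩ := by
      refine rel_of_basis τ hd s hA ?_ ?_ ?_ ?_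
      · rw [hAw]; module
      · rw [hB, hA]; module
      · rw [hB, hAw, hw]; module
      · rw [← hCd, ← hvd]; module
    have := of_mat_valid (hr.valid hv)
    simp only [zero_mul, sub_zero, mul_ne_zero_iff] at this
    exact ⟨⟨(x, t, y), ⟨this.1.1, this.2.1⟩, this.1.2, this.2.2⟩, hr⟩

theorem count_plane : HasCount (Tri.rel (R := ZMod p) (M := ZMod p × ZMod p)) Tri.Valid
    ((((p - 2) + ((p - 2) * (p - 2) + (p - 1) * (p - 1))) +
      (p - 2) * (p + ((p - 1) + (p - 2) * (p - 2)))) +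
    (((p - 1) * (p - 1) + (p - 1) * ((p - 1) * p)) +
      (p - 1) * ((p - 1) * p + ((p - 1) * p + ((p - 1) * (p - 1)) * (p - 1))))) :=
  HasCount.split' Tri.Ext (fun _ _ => Tri.rel.ext)
    (HasCount.split' Tri.CZero (fun _ _ => Tri.rel.cZero)
      (HasCount.split' (fun τ => Scal τ.A) (fun _ _ => rel_scalA) leafE1
        (HasCount.split' Eig (fun _ _ => rel_eig) leafE3 leafE2)) leafE4)
    (HasCount.split' (fun τ => Scal τ.A) (fun _ _ => rel_scalA)
      (HasCount.split' (fun τ => Scal τ.B) (fun _ _ => rel_scalB) leafN1 leafN2) leafN3)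

end planeleaves

/-- For every prime `p`, there are exactly `2p^4 - p^3 - p^2 - 3p - 1` medial
quasigroups of order `p^2`, up to isomorphism. -/
theorem mq_order_p_squared (p : ℕ) (hp : p.Prime) :
    (mqN (p ^ 2) : ℤ) = 2 * (p : ℤ) ^ 4 - (p : ℤ) ^ 3 - (p : ℤ) ^ 2 - 3 * (p : ℤ) - 1 := by
  have : Fact p.Prime := ⟨hp⟩
  rw [mq_of_counts hp count_psq count_plane]
  obtain ⟨q, rfl⟩ := Nat.exists_eq_add_of_le hp.two_le
  have e1 : 2 + q - 1 = q + 1 := by omega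
  have e2 : 2 + q - 2 = q := by omega
  rw [e1, e2]
  push_cast
  ring
end

section
/- For every prime p, the number of medial quasigroups of order p, counted up to isomorphism, is exactly p^2 - p - 1. -/
/-- A map of `ZMod p` which is additive up to a constant is affine. -/
theorem affine_of_add {p : ℕ} [NeZero p] (f : ZMod p → ZMod p)
    (h : ∀ x y, f (x + y) = f x + f y - f 0) : ∃ a c, ∀ x, f x = a * x + c := by
  let g : ZMod p →+ ZMod p := AddMonoidHom.mk' (fun x => f x - f 0) (by
    intro x y; simp only [h]; ring)
  refine ⟨g 1, f 0, fun x => ?_⟩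
  have h1 : g x = g 1 * x := by
    have h2 : g (x.val • (1 : ZMod p)) = x.val • g 1 := map_nsmul g _ _
    rw [nsmul_eq_mul, nsmul_eq_mul, ZMod.natCast_zmod_val, mul_one] at h2
    rw [h2, mul_comm]
  have h3 : g x = f x - f 0 := rfl
  rw [← h1, h3]; ring

/-- Toyoda's theorem in prime order. -/
theorem toyoda_s3 {p : ℕ} [Fact p.Prime] {Q : Type} (hc : Nat.card Q = p)
    (op : Q → Q → Q) (hq : IsQuasigroup op) (hm : IsMedial op) :
    ∃ (e : Q ≃ ZMod p) (a b c : ZMod p), a ≠ 0 ∧ b ≠ 0 ∧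
      ∀ x y, e (op x y) = a * e x + b * e y + c := by
  have hpos : 0 < Nat.card Q := by rw [hc]; exact (Fact.out : p.Prime).pos
  have hne : Nonempty Q := (Nat.card_pos_iff.1 hpos).1
  obtain ⟨o⟩ := hne
  let r : Q ≃ Q := Equiv.ofBijective _ (hq.2 o)
  let l : Q ≃ Q := Equiv.ofBijective _ (hq.1 o)
  let add : Q → Q → Q := fun x y => op (r.symm x) (l.symm y)
  let z : Q := op o o
  have hop : ∀ x y, op x y = add (r x) (l y) := by intro x y; simp [add]
  have hro : r o = z := rfl
  have hlo : l o = z := rfl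
  have haz : ∀ x, add x z = x := by
    intro x
    have : l.symm z = o := by rw [← hlo]; simp
    simp only [add, this]
    exact r.apply_symm_apply x
  have hza : ∀ x, add z x = x := by
    intro x
    have : r.symm z = o := by rw [← hro]; simp
    simp only [add, this]
    exact l.apply_symm_apply x
  have addR : ∀ w v, ∃ x, add w x = v := by
    intro w v
    obtain ⟨x, hx⟩ := (hq.1 (r.symm w)).2 v
    exact ⟨l x, by simpa [add] using hx⟩
  have addL : ∀ w v, ∃ x, add x w = v := by
    intro w v
    obtain ⟨x, hx⟩ := (hq.2 (l.symm w)).2 v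
    exact ⟨r x, by simpa [add] using hx⟩
  -- the medial law
  have med : ∀ X y u V, add (r (add X (l y))) (l (add (r u) V)) =
      add (r (add X (l u))) (l (add (r y) V)) := by
    intro X y u V
    have := hm (r.symm X) y u (l.symm V)
    simpa [hop] using this
  obtain ⟨V0', hV0'⟩ := l.surjective z
  obtain ⟨V0, hV0⟩ := addR (r o) V0'
  let α : Q → Q := fun u => l (add (r u) V0)
  have e1 : ∀ X u V, add (r X) (l (add (r u) V)) =
      add (r (add X (l u))) (l (add (r o) V)) := by
    intro X u V
    have := med X o u V
    rwa [hlo, haz] at this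
  have e2 : ∀ X u, r (add X (l u)) = add (r X) (α u) := by
    intro X u
    have := e1 X u V0
    rw [hV0, hV0', haz] at this
    exact this.symm
  have e3 : ∀ s u V, add s (l (add (r u) V)) = add (add s (α u)) (l (add (r o) V)) := by
    intro s u V
    have := e1 (r.symm s) u V
    rwa [e2, r.apply_symm_apply] at this
  have e4 : ∀ u V, l (add (r u) V) = add (α u) (l (add (r o) V)) := by
    intro u V
    have := e3 z u V
    rwa [hza, hza] at this
  have assoc : ∀ x y w, add (add x y) w = add x (add y w) := by
    intro x y w
    obtain ⟨y1, hy1⟩ := addL V0 (l.symm y)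
    have hy : α (r.symm y1) = y := by simp [α, hy1]
    obtain ⟨V, hV⟩ := addR (r o) (l.symm w)
    have h1 := e3 x (r.symm y1) V
    rw [e4, hy, hV, l.apply_symm_apply] at h1
    exact h1.symm
  choose inv hinv using fun w => addL w z
  letI : Mul Q := ⟨add⟩
  letI : One Q := ⟨z⟩
  letI : Inv Q := ⟨inv⟩
  letI : Group Q := Group.ofLeftAxioms assoc hza hinv
  haveI : IsCyclic Q := isCyclic_of_prime_card hc
  let e0 : Multiplicative (ZMod (Nat.card Q)) ≃* Q := zmodCyclicMulEquiv inferInstance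
  subst hc
  let e : Q ≃ ZMod (Nat.card Q) := e0.symm.toEquiv.trans Multiplicative.toAdd
  have he : ∀ x y, e (add x y) = e x + e y := by
    intro x y
    change Multiplicative.toAdd (e0.symm (x * y)) = _
    rw [map_mul]; rfl
  have hez : e z = 0 := by
    have := he z z
    rw [hza] at this
    simpa using this
  have hz' : e.symm 0 = z := by rw [← hez]; simp
  have hes : ∀ x y, e.symm (x + y) = add (e.symm x) (e.symm y) := by
    intro x y; apply e.injective; rw [he]; simp
  obtain ⟨a, c1, h1⟩ := affine_of_add (fun x => e (r (e.symm x))) (by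
    intro x y
    have k1 := congrArg e (e2 (e.symm x) (l.symm (e.symm y)))
    have k2 := congrArg e (e2 z (l.symm (e.symm y)))
    rw [hza] at k2
    simp only [l.apply_symm_apply, he] at k1 k2
    simp only [hes, hz', k1, k2]; ring)
  obtain ⟨b, c2, h2⟩ := affine_of_add (fun x => e (l (e.symm x))) (by
    intro x y
    have k1 := congrArg e (e4 (r.symm (e.symm x)) (e.symm y))
    have k2 := congrArg e (e4 o (e.symm y))
    have k3 := congrArg e (e4 o z)
    have k4 := congrArg e (e4 (r.symm (e.symm x)) z)
    rw [hro, hza] at k2 k3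
    rw [haz] at k4
    simp only [r.apply_symm_apply, he, hro, hza] at k1 k2 k3 k4
    simp only [hes, hz']
    linear_combination k1 - k2 + k3 - k4)
  have h1' : ∀ x, e (r x) = a * e x + c1 := by intro x; simpa using h1 (e x)
  have h2' : ∀ x, e (l x) = b * e x + c2 := by intro x; simpa using h2 (e x)
  have h01 : (0 : ZMod (Nat.card Q)) ≠ 1 := zero_ne_one
  refine ⟨e, a, b, c1 + c2, ?_, ?_, ?_⟩
  · rintro rfl
    apply h01
    apply e.symm.injective
    apply r.injective
    apply e.injective
    rw [h1', h1']; ring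
  · rintro rfl
    apply h01
    apply e.symm.injective
    apply l.injective
    apply e.injective
    rw [h2', h2']; ring
  · intro x y
    rw [hop, he, h1', h2']; ring

/-- Index type for the isomorphism classes. -/
abbrev Cls (p : ℕ) : Type :=
  ({x : ZMod p // x ≠ 0} × {x : ZMod p // x ≠ 0}) ⊕ {x : ZMod p // x ≠ 0 ∧ x ≠ 1}

/-- Left coefficient. -/
def cA {p : ℕ} : Cls p → ZMod p
  | .inl t => t.1.1
  | .inr t => t.1

/-- Right coefficient. -/
def cB {p : ℕ} : Cls p → ZMod p
  | .inl t => t.2.1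
  | .inr t => 1 - t.1

/-- Constant. -/
def cD {p : ℕ} : Cls p → ZMod p
  | .inl _ => 0
  | .inr _ => 1

theorem cA_ne {p : ℕ} (t : Cls p) : cA t ≠ 0 := by
  rcases t with t | t
  · exact t.1.2
  · exact t.2.1

theorem cB_ne {p : ℕ} (t : Cls p) : cB t ≠ 0 := by
  rcases t with t | t
  · exact t.2.2
  · exact sub_ne_zero.2 (Ne.symm t.2.2)

theorem card_cls (p : ℕ) [hp : Fact p.Prime] :
    (Nat.card (Cls p) : ℤ) = (p : ℤ) ^ 2 - (p : ℤ) - 1 := by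
  have h2 := hp.out.two_le
  have c1 : Nat.card {x : ZMod p // x ≠ 0} = p - 1 := by
    rw [Nat.card_eq_fintype_card, Fintype.card_subtype_compl]
    simp [ZMod.card]
  have c2 : Nat.card {x : ZMod p // x ≠ 0 ∧ x ≠ 1} = p - 2 := by
    have : Nat.card {x : ZMod p // x ≠ 0 ∧ x ≠ 1} = (({0, 1} : Finset (ZMod p))ᶜ).card := by
      rw [Nat.card_eq_fintype_card]
      apply Fintype.card_of_subtype
      intro x; simp
    rw [this, Finset.card_compl, ZMod.card, Finset.card_pair zero_ne_one]
  rw [Nat.card_sum, Nat.card_prod, c1, c2]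
  push_cast [Nat.cast_sub h2, Nat.cast_sub (show 1 ≤ p by omega)]
  ring

theorem iso_equivalence (Q : Type) (P : (Q → Q → Q) → Prop) :
    Equivalence (fun (o₁ o₂ : {op : Q → Q → Q // P op}) => QuasigroupIso o₁.1 o₂.1) := by
  refine ⟨fun o => ⟨Equiv.refl _, fun _ _ => rfl⟩, ?_, ?_⟩
  · rintro o₁ o₂ ⟨f, hf⟩
    refine ⟨f.symm, fun x y => ?_⟩
    apply f.injective
    rw [hf]; simp
  · rintro o₁ o₂ o₃ ⟨f, hf⟩ ⟨g, hg⟩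
    exact ⟨f.trans g, fun x y => by simp [hf, hg]⟩

/-- Isomorphic models have the same index. -/
theorem cls_inj {p : ℕ} [Fact p.Prime] (s t : Cls p) (f : ZMod p ≃ ZMod p)
    (hf : ∀ x y, f (cA s * x + cB s * y + cD s) = cA t * f x + cB t * f y + cD t) : s = t := by
  have ha := cA_ne s
  have hb := cB_ne s
  have key : ∀ x y, f (x + y + cD s) =
      cA t * f (x / cA s) + cB t * f (y / cB s) + cD t := by
    intro x y
    rw [← hf]; congr 1; field_simp
  obtain ⟨u, v, huv⟩ := affine_of_add (fun x => f (x + cD s)) (by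
    intro x y
    have k1 := key x y
    have k2 := key x 0
    have k3 := key 0 y
    have k4 := key 0 0
    simp only [add_zero, zero_add] at k1 k2 k3 k4 ⊢
    linear_combination k1 - k2 - k3 + k4)
  have hf' : ∀ x, f x = u * x + (v - u * cD s) := by
    intro x
    have := huv (x - cD s)
    simp only [sub_add_cancel] at this
    rw [this]; ring
  generalize v - u * cD s = w at hf'
  have hu : u ≠ 0 := by
    rintro rfl
    apply zero_ne_one (α := ZMod p)
    apply f.injective
    rw [hf', hf']; ring
  simp only [hf'] at hf
  have k00 := hf 0 0
  have k10 := hf 1 0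
  have k01 := hf 0 1
  have eA : cA s = cA t := by
    apply mul_left_cancel₀ hu; linear_combination k10 - k00
  have eB : cB s = cB t := by
    apply mul_left_cancel₀ hu; linear_combination k01 - k00
  rcases s with ⟨⟨s1, h1⟩, ⟨s2, h2⟩⟩ | ⟨s, hs⟩ <;> rcases t with ⟨⟨t1, h3⟩, ⟨t2, h4⟩⟩ | ⟨t, ht⟩ <;>
    simp only [cA, cB, cD] at eA eB k00
  · subst eA eB; rfl
  · exfalso
    apply zero_ne_one (α := ZMod p)
    linear_combination k00
  · exfalso
    apply hu
    rw [← eA, ← eB] at k00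
    linear_combination k00
  · subst eA; rfl

theorem cls_surj {p : ℕ} [Fact p.Prime] {Q : Type} (op : Q → Q → Q) (e : Q ≃ ZMod p)
    (a b c : ZMod p) (ha : a ≠ 0) (hb : b ≠ 0)
    (h : ∀ x y, e (op x y) = a * e x + b * e y + c) :
    ∃ (t : Cls p) (e' : Q ≃ ZMod p),
      ∀ x y, e' (op x y) = cA t * e' x + cB t * e' y + cD t := by
  by_cases hab : a + b = 1
  · by_cases hc : c = 0
    · exact ⟨.inl ⟨⟨a, ha⟩, ⟨b, hb⟩⟩, e, fun x y => by simp [cA, cB, cD, h, hc]⟩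
    · refine ⟨.inr ⟨a, ha, ?_⟩, e.trans (Equiv.mulLeft₀ c⁻¹ (inv_ne_zero hc)), fun x y => ?_⟩
      · rintro rfl
        apply hb; linear_combination hab
      · obtain rfl : b = 1 - a := by linear_combination hab
        change c⁻¹ * e (op x y) = a * (c⁻¹ * e x) + (1 - a) * (c⁻¹ * e y) + 1
        rw [h]
        field_simp
  · have hd : 1 - (a + b) ≠ 0 := sub_ne_zero.2 (Ne.symm hab)
    refine ⟨.inl ⟨⟨a, ha⟩, ⟨b, hb⟩⟩, e.trans (Equiv.subRight (c / (1 - (a + b)))), fun x y => ?_⟩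
    have hk : c / (1 - (a + b)) * (1 - (a + b)) = c := div_mul_cancel₀ _ hd
    simp only [cA, cB, cD, Equiv.trans_apply, Equiv.subRight_apply, h]
    linear_combination -hk

/-- The model operation, transported along a bijection. -/
def modelOp {p : ℕ} {Q : Type} (e : Q ≃ ZMod p) (t : Cls p) (x y : Q) : Q :=
  e.symm (cA t * e x + cB t * e y + cD t)

theorem modelOp_quasi {p : ℕ} [Fact p.Prime] {Q : Type} (e : Q ≃ ZMod p) (t : Cls p) :
    IsQuasigroup (modelOp e t) ∧ IsMedial (modelOp e t) := by
  haveI : Finite Q := Finite.of_equiv _ e.symm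
  refine ⟨⟨fun w => ?_, fun w => ?_⟩, ?_⟩
  · apply Finite.injective_iff_bijective.1
    intro x y hxy
    apply e.injective
    apply mul_left_cancel₀ (cB_ne t)
    have := e.symm.injective hxy
    linear_combination this
  · apply Finite.injective_iff_bijective.1
    intro x y hxy
    apply e.injective
    apply mul_left_cancel₀ (cA_ne t)
    have := e.symm.injective hxy
    linear_combination this
  · intro x y u v
    simp only [modelOp, Equiv.apply_symm_apply]
    congr 1; ring

/-- For every prime `p`, there are exactly `p^2 - p - 1` medial quasigroups of
order `p`, up to isomorphism. -/
theorem mq_order_p (p : ℕ) (hp : p.Prime) :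
    (mqN p : ℤ) = (p : ℤ) ^ 2 - (p : ℤ) - 1 := by
  haveI : Fact p.Prime := ⟨hp⟩
  rw [← card_cls p]
  let e : Fin p ≃ ZMod p := Fintype.equivOfCardEq (by simp [ZMod.card])
  let F : Cls p → Quot fun
      (op₁ op₂ : {op : Fin p → Fin p → Fin p // IsQuasigroup op ∧ IsMedial op}) =>
      QuasigroupIso op₁.1 op₂.1 := fun t => Quot.mk _ ⟨modelOp e t, modelOp_quasi e t⟩
  have hF : Function.Bijective F := by
    constructor
    · intro s t hst
      have h1 := (Equivalence.eqvGen_iff (iso_equivalence _ _)).1 (Quot.eqvGen_exact hst)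
      obtain ⟨f, hf⟩ := h1
      refine cls_inj s t ((e.symm.trans f).trans e) fun x y => ?_
      have := congrArg e (hf (e.symm x) (e.symm y))
      simpa [modelOp] using this
    · intro q
      induction q using Quot.ind with
      | mk o =>
        obtain ⟨op, hq, hm⟩ := o
        obtain ⟨e1, a, b, c, ha, hb, h⟩ := toyoda_s3 (p := p) (by simp) op hq hm
        obtain ⟨t, e2, h2⟩ := cls_surj op e1 a b c ha hb h
        refine ⟨t, Quot.sound ⟨e.trans e2.symm, fun x y => ?_⟩⟩
        apply e2.injective
        simp [modelOp, h2]
  rw [Nat.card_congr (Equiv.ofBijective F hF)]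
  rfl
end
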